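/- arXiv:1911.03550 — 6 statements merged into one kernel-verified Lean document; each statement's English description precedes it below -/
import Mathlib

section
/- Fix N ≥ 1 and let X be a type. For every function F : X^N → ℝ that is invariant under all permutations of its N arguments, there exist functions G_m : X^m → ℝ for 1 ≤ m ≤ N−1, each invariant under permutations of its arguments and depending only on F (not on any particle configuration), such that for every finite J and every injective map r : Fin J → X: (1/N!) · Σ_{j ∈ (Fin J)^N} F(r(j_1), …, r(j_N)) = Σ_{j_1 < j_2 < ⋯ < j_N} F(r(j_1), …, r(j_N)) + Σ_{m=1}^{N−1} Σ_{k_1 < ⋯ < k_m} G_m(r(k_1), …, r(k_m)). That is, replacing the sum over ordered clusters of N distinct particles by the unrestricted sum over all N-tuples of particle indices (divided by N!) introduces only a correction of interaction order at most N−1. -/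
open scoped BigOperators Classical

open Finset in
/-- Every map of finite linear orders factors uniquely as a surjection onto `Fin m` followed by a
strictly monotone map, where `m` is the number of values taken. -/
theorem sum_strictMono_sum_surjective {α ι M : Type*} [Fintype α] [Fintype ι] [LinearOrder ι]
    [AddCommMonoid M] (m : ℕ) (g : (α → ι) → M) :
    ∑ k ∈ univ.filter (fun k : Fin m → ι => StrictMono k),
      ∑ f ∈ univ.filter (fun f : α → Fin m => Function.Surjective f), g (k ∘ f)
      = ∑ j ∈ univ.filter (fun j : α → ι => (univ.image j).card = m), g j := by
  rw [← sum_product']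
  refine sum_bij (fun p _ => p.1 ∘ p.2) ?_ ?_ ?_ (fun _ _ => rfl)
  · rintro ⟨k, f⟩ h
    simp only [mem_product, mem_filter_univ] at h ⊢
    rw [← image_image, image_univ_of_surjective h.2, card_image_of_injective _ h.1.injective,
      card_univ, Fintype.card_fin]
  · rintro ⟨k, f⟩ h ⟨k', f'⟩ h' heq
    simp only [mem_product, mem_filter_univ] at h h' heq
    have hk : k = k' := by
      rw [← StrictMono.range_inj h.1 h'.1, ← h.2.range_comp, heq, h'.2.range_comp]
    subst hk
    rw [h.1.injective.comp_left heq]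
  · intro j hj
    rw [mem_filter_univ] at hj
    let e := (univ.image j).orderIsoOfFin hj
    have he (i : Fin m) : (e i : ι) ∈ univ.image j := (e i).2
    refine ⟨⟨fun i => e i, fun a => e.symm ⟨j a, mem_image_of_mem j (mem_univ a)⟩⟩, ?_, ?_⟩
    · simp only [mem_product, mem_filter_univ]
      refine ⟨fun a b hab => e.strictMono hab, fun i => ?_⟩
      obtain ⟨a, -, ha⟩ := mem_image.1 (he i)
      exact ⟨a, e.symm_apply_eq.2 (Subtype.ext ha)⟩
    · ext a
      simp

open Finset in
/-- A sum of a symmetric function over all surjective relabellings of its arguments. -/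
theorem sum_surjective_comp_of_symmetric {X : Type*} (N : ℕ) (F : (Fin N → X) → ℝ)
    (hF : ∀ (σ : Equiv.Perm (Fin N)) (x : Fin N → X), F (x ∘ σ) = F x) (x : Fin N → X) :
    ∑ f ∈ univ.filter (fun f : Fin N → Fin N => Function.Surjective f), F (x ∘ f)
      = (N.factorial : ℝ) * F x := by
  have h : ∑ σ : Equiv.Perm (Fin N), F (x ∘ σ)
      = ∑ f ∈ univ.filter (fun f : Fin N → Fin N => Function.Surjective f), F (x ∘ f) := by
    refine sum_bij (fun σ _ => σ) (fun σ _ => ?_) (fun σ _ τ _ hστ => DFunLike.coe_injective hστ)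
      (fun f hf => ?_) (fun _ _ => rfl)
    · simpa using σ.surjective
    · rw [mem_filter_univ] at hf
      exact ⟨Equiv.ofBijective f (Finite.surjective_iff_bijective.1 hf), mem_univ _, rfl⟩
  rw [← h]
  simp [hF, Fintype.card_perm]

/-- Replacing the sum of a symmetric `N`-body function over ordered clusters of distinct
particles by the unrestricted sum over all `N`-tuples of particle indices (divided by `N!`)
introduces only a correction of interaction order at most `N − 1`: there exist symmetric
functions `G_m` (`1 ≤ m ≤ N−1`), depending only on `F`, such that for every injective
configuration `r : Fin J → X`,
`(1/N!) ∑_{j ∈ (Fin J)^N} F(r∘j) = ∑_{j₁<⋯<j_N} F(r(j₁),…,r(j_N))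
  + ∑_{m=1}^{N−1} ∑_{k₁<⋯<k_m} G_m(r(k₁),…,r(k_m))`. -/
theorem unrestricted_sum_eq_cluster_sum_plus_lower_order
    {X : Type*} (N : ℕ) (hN : 1 ≤ N)
    (F : (Fin N → X) → ℝ)
    (hF : ∀ (σ : Equiv.Perm (Fin N)) (x : Fin N → X), F (x ∘ σ) = F x) :
    ∃ G : (m : ℕ) → (Fin m → X) → ℝ,
      (∀ (m : ℕ) (σ : Equiv.Perm (Fin m)) (x : Fin m → X), G m (x ∘ σ) = G m x) ∧
      ∀ (J : ℕ) (r : Fin J → X), Function.Injective r →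
        ((N.factorial : ℝ))⁻¹ * ∑ j : Fin N → Fin J, F (r ∘ j)
          = (∑ j ∈ Finset.univ.filter (fun j : Fin N → Fin J => StrictMono j), F (r ∘ j))
            + ∑ m ∈ Finset.Icc 1 (N - 1),
                ∑ k ∈ Finset.univ.filter (fun k : Fin m → Fin J => StrictMono k),
                  G m (r ∘ k) := by
  refine ⟨fun m y => (N.factorial : ℝ)⁻¹ *
    ∑ f ∈ Finset.univ.filter (fun f : Fin N → Fin m => Function.Surjective f), F (y ∘ f), ?_, ?_⟩
  · intro m σ y
    dsimp only
    congr 1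
    refine Finset.sum_equiv (Equiv.arrowCongr (Equiv.refl _) σ) (fun f => ?_) (fun f _ => rfl)
    simp [Equiv.arrowCongr]
  · intro J r _
    have hmaps : ∀ j ∈ (Finset.univ : Finset (Fin N → Fin J)),
        (Finset.univ.image j).card ∈ Finset.Icc 1 N := by
      intro j _
      have : Nonempty (Fin N) := ⟨⟨0, hN⟩⟩
      refine Finset.mem_Icc.2 ⟨Finset.card_pos.2 (Finset.univ_nonempty.image j), ?_⟩
      simpa using Finset.card_image_le (s := Finset.univ) (f := j)
    rw [← Finset.sum_fiberwise_of_maps_to hmaps]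
    have hcluster (m : ℕ) :
        ∑ j ∈ Finset.univ.filter (fun j : Fin N → Fin J => (Finset.univ.image j).card = m),
            F (r ∘ j)
          = ∑ k ∈ Finset.univ.filter (fun k : Fin m → Fin J => StrictMono k),
              ∑ f ∈ Finset.univ.filter (fun f : Fin N → Fin m => Function.Surjective f),
                F ((r ∘ k) ∘ f) := by
      simp only [Function.comp_assoc]
      convert (sum_strictMono_sum_surjective m (fun j : Fin N → Fin J => F (r ∘ j))).symm
    simp only [hcluster, ← Finset.mul_sum]
    obtain ⟨n, rfl⟩ := Nat.exists_eq_add_of_le' hN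
    rw [Finset.sum_Icc_succ_top (by omega), mul_add, add_comm, Nat.add_sub_cancel]
    congr 1
    simp_rw [sum_surjective_comp_of_symmetric (n + 1) F hF, ← Finset.mul_sum]
    exact inv_mul_cancel_left₀ (by positivity) _
end

section
/- Let X be a type and for each n ≥ 1 let W_n : X^n → ℝ be a function invariant under all permutations of its n arguments. Suppose that for every N ≥ 1 and every injective tuple (r_1, …, r_N) ∈ X^N, Σ_{n=1}^{N} Σ_{S ⊆ {1,…,N}, |S| = n} W_n((r_j)_{j ∈ S}) = 0, where (r_j)_{j∈S} lists the entries of r indexed by S in increasing order of index. Then W_n vanishes on all injective tuples: W_n(r_1, …, r_n) = 0 for every n ≥ 1 and every pairwise-distinct (r_1, …, r_n) ∈ X^n. Consequently, the body-order expansion of a potential energy surface E(R) = Σ_n Σ_{|S|=n} W_n over fully permutation-invariant components W_n is unique on configurations of pairwise-distinct points. -/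
open scoped BigOperators Classical

/-- The identity is the only strictly monotone self-map of `Fin n`. -/
theorem Fin.strictMono_self_iff {n : ℕ} {k : Fin n → Fin n} : StrictMono k ↔ k = id := by
  refine ⟨fun hk => (hk.range_inj strictMono_id).mp ?_, fun hk => hk ▸ strictMono_id⟩
  rw [(Finite.surjective_of_injective hk.injective).range_eq, Set.range_id]

/-- Uniqueness of the body-order expansion over fully permutation-invariant components:
if symmetric functions `W n : X^n → ℝ` satisfy, for every `N ≥ 1` and every injective
tuple `r : Fin N → X`,
`∑_{n=1}^N ∑_{S ⊆ {1,…,N}, |S| = n} W_n((r_j)_{j∈S}) = 0`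
(the inner sum being over subsets listed in increasing order, i.e. over strictly monotone
maps `Fin n → Fin N`), then every `W n` vanishes on all injective tuples. -/
theorem body_order_expansion_unique
    {X : Type*} (W : (n : ℕ) → (Fin n → X) → ℝ)
    (hsym : ∀ (n : ℕ) (σ : Equiv.Perm (Fin n)) (x : Fin n → X), W n (x ∘ σ) = W n x)
    (h : ∀ N : ℕ, 1 ≤ N → ∀ r : Fin N → X, Function.Injective r →
        ∑ n ∈ Finset.Icc 1 N,
          ∑ k ∈ Finset.univ.filter (fun k : Fin n → Fin N => StrictMono k),
            W n (r ∘ k) = 0) :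
    ∀ n : ℕ, 1 ≤ n → ∀ r : Fin n → X, Function.Injective r → W n r = 0 := by
  intro n
  induction n using Nat.strong_induction_on with
  | _ n ih =>
    intro hn r hr
    have hsum := h n hn r hr
    rw [Finset.sum_eq_single_of_mem n (Finset.mem_Icc.mpr ⟨hn, le_rfl⟩)] at hsum
    · simpa [Fin.strictMono_self_iff, Finset.filter_eq'] using hsum
    · intro m hm hmn
      obtain ⟨hm1, hmle⟩ := Finset.mem_Icc.mp hm
      refine Finset.sum_eq_zero fun k hk => ?_
      exact ih m (lt_of_le_of_ne hmle hmn) hm1 _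
        (hr.comp (Finset.mem_filter.mp hk).2.injective)
end

section
/- Fix N ≥ 1 and let the group G = S_N × O(3) act on (ℝ³)^N by (σ, Q) · (r_1, …, r_N) = (Q r_{σ^{-1}(1)}, …, Q r_{σ^{-1}(N)}), where S_N is the symmetric group on N letters and O(3) is the real orthogonal group in dimension 3. Let K ⊆ (ℝ³)^N be a compact set invariant under this action, and let f : K → ℝ be a continuous function invariant under the action (f(g·x) = f(x) whenever x, g·x ∈ K). Then for every ε > 0 there exists a polynomial p in the 3N real coordinates, invariant under the action of G on (ℝ³)^N, such that sup_{x ∈ K} |f(x) − p(x)| ≤ ε. That is, G-invariant polynomials are uniformly dense in the G-invariant continuous functions on K. -/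
/-- Two finite families of vectors in `ℝ^ι` with the same Gram matrix differ by an orthogonal
transformation. -/
theorem exists_orthogonal_mulVec_eq_of_dotProduct_eq {ι κ : Type*} [Fintype ι] [DecidableEq ι]
    [Fintype κ] (x y : κ → ι → ℝ) (h : ∀ i j, x i ⬝ᵥ x j = y i ⬝ᵥ y j) :
    ∃ Q ∈ Matrix.orthogonalGroup ι ℝ, ∀ i, Q.mulVec (x i) = y i := by
  classical
  let X := Fintype.linearCombination ℝ (fun i => WithLp.toLp 2 (x i) : κ → EuclideanSpace ℝ ι)
  let Y := Fintype.linearCombination ℝ (fun i => WithLp.toLp 2 (y i) : κ → EuclideanSpace ℝ ι)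
  have hXY : ∀ c, ‖X c‖ = ‖Y c‖ := by
    intro c
    have : inner ℝ (X c) (X c) = inner ℝ (Y c) (Y c) := by
      simp only [X, Y, Fintype.linearCombination_apply, sum_inner, inner_sum, inner_smul_left,
        inner_smul_right, EuclideanSpace.inner_toLp_toLp, star_trivial, h]
    rw [real_inner_self_eq_norm_sq, real_inner_self_eq_norm_sq] at this
    exact (sq_eq_sq₀ (norm_nonneg _) (norm_nonneg _)).1 this
  obtain ⟨s, hs⟩ := X.rangeRestrict.exists_rightInverse_of_surjective X.range_rangeRestrict
  have hXs : ∀ v, X (s v) = v := fun v => congrArg Subtype.val (LinearMap.congr_fun hs v)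
  let L : LinearMap.range X →ₗᵢ[ℝ] EuclideanSpace ℝ ι :=
    ⟨Y ∘ₗ s, fun v => by rw [LinearMap.comp_apply, ← hXY, hXs, Submodule.coe_norm]⟩
  have hL : ∀ c, L.extend (X c) = Y c := by
    intro c
    rw [show X c = ((⟨X c, c, rfl⟩ : LinearMap.range X) : EuclideanSpace ℝ ι) from rfl,
      LinearIsometry.extend_apply]
    change Y (s _) = Y c
    rw [← sub_eq_zero, ← map_sub, ← norm_eq_zero, ← hXY, map_sub, hXs, sub_self, norm_zero]
  have hX : ∀ i, X (Pi.single i 1) = WithLp.toLp 2 (x i) := fun i => by simp [X]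
  have hY : ∀ i, Y (Pi.single i 1) = WithLp.toLp 2 (y i) := fun i => by simp [Y]
  refine ⟨Matrix.of fun a b => L.extend (EuclideanSpace.single b 1) a, ?_, fun i => ?_⟩
  · rw [Matrix.mem_orthogonalGroup_iff']
    ext a b
    have := L.extend.inner_map_map (EuclideanSpace.single a 1) (EuclideanSpace.single b 1)
    rw [EuclideanSpace.inner_single_left, PiLp.inner_apply] at this
    simpa [-LinearIsometry.inner_map_map, Matrix.mul_apply, Matrix.one_apply, Pi.single_apply,
      mul_comm] using this
  · have hi := hL (Pi.single i 1)
    rw [hX, hY] at hi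
    have hx : WithLp.toLp 2 (x i) = ∑ b, x i b • EuclideanSpace.single b (1 : ℝ) := by
      ext a
      simp [Pi.single_apply]
    rw [hx, map_sum] at hi
    ext a
    have := congrArg (fun v : EuclideanSpace ℝ ι => v a) hi
    simpa [Matrix.mulVec, dotProduct, mul_comm] using this

/-- Stone–Weierstrass on a compact subset of `ℝ^κ`. -/
theorem exists_mvPolynomial_near_of_isCompact {κ : Type*} {S : Set (κ → ℝ)} (hS : IsCompact S)
    (F : C(S, ℝ)) {ε : ℝ} (hε : 0 < ε) :
    ∃ q : MvPolynomial κ ℝ, ∀ y : S, |F y - MvPolynomial.eval y.1 q| ≤ ε := by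
  have := isCompact_iff_compactSpace.1 hS
  let coord : κ → C(S, ℝ) := fun k => ⟨fun y => y.1 k, (continuous_apply k).comp continuous_subtype_val⟩
  have hsep : (MvPolynomial.aeval (R := ℝ) coord).range.SeparatesPoints := by
    intro y z hyz
    obtain ⟨k, hk⟩ := Function.ne_iff.1 (Subtype.coe_injective.ne hyz)
    exact ⟨coord k, ⟨coord k, ⟨MvPolynomial.X k, by simp⟩, rfl⟩, hk⟩
  obtain ⟨⟨_, q, rfl⟩, hq⟩ :=
    ContinuousMap.exists_mem_subalgebra_near_continuousMap_of_separatesPoints _ hsep F ε hε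
  refine ⟨q, fun y => ?_⟩
  have heval : MvPolynomial.aeval coord q y = MvPolynomial.eval y.1 q := by
    clear hq
    induction q using MvPolynomial.induction_on with
    | C a => simp
    | add p q hp hq => simp [hp, hq]
    | mul_X p k hp => simp [hp, coord]
  rw [abs_sub_comm, ← heval]
  exact ((ContinuousMap.norm_coe_le_norm _ y).trans hq.le)

/-- A continuous function on a compact set that is constant on the fibres of a continuous map `Φ`
descends to a continuous function on the image of `Φ`. -/
theorem IsCompact.exists_continuousMap_factor {X Y Z : Type*} [TopologicalSpace X]
    [TopologicalSpace Y] [T2Space Y] [TopologicalSpace Z] {K : Set X} (hK : IsCompact K)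
    {Φ : X → Y} (hΦ : ContinuousOn Φ K) {f : X → Z} (hf : ContinuousOn f K)
    (h : ∀ x ∈ K, ∀ y ∈ K, Φ x = Φ y → f x = f y) :
    ∃ F : C(Φ '' K, Z), ∀ x (hx : x ∈ K), F ⟨Φ x, x, hx, rfl⟩ = f x := by
  have := isCompact_iff_compactSpace.1 hK
  let g : C(K, Φ '' K) := ⟨fun x => ⟨Φ x, x, x.2, rfl⟩, hΦ.domRestrict.subtype_mk _⟩
  have hg : Topology.IsQuotientMap g := by
    refine g.continuous.isClosedMap.isQuotientMap g.continuous ?_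
    rintro ⟨_, x, hx, rfl⟩
    exact ⟨⟨x, hx⟩, rfl⟩
  have hfac : Function.FactorsThrough (⟨K.domRestrict f, hf.domRestrict⟩ : C(K, Z)) g :=
    fun x y hxy => h x x.2 y y.2 (congrArg Subtype.val hxy)
  refine ⟨hg.lift _ hfac, fun x hx => ?_⟩
  exact DFunLike.congr_fun (hg.lift_comp _ hfac) (⟨x, hx⟩ : K)


/-- Invariant Stone–Weierstrass: let `G = S_N × O(3)` act on `(ℝ³)^N` by
`(σ, Q) · (r_1, …, r_N) = (Q r_{σ⁻¹(1)}, …, Q r_{σ⁻¹(N)})`. If `K ⊆ (ℝ³)^N` is a compact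
invariant set and `f` is a continuous invariant function on `K`, then for every `ε > 0`
there is a `G`-invariant real polynomial `p` in the `3N` coordinates with
`|f(x) − p(x)| ≤ ε` for all `x ∈ K`. -/
theorem invariant_polynomials_dense (N : ℕ) (hN : 1 ≤ N)
    (K : Set (Fin N → Fin 3 → ℝ)) (hK : IsCompact K)
    (hKinv : ∀ (σ : Equiv.Perm (Fin N)) (Q : Matrix (Fin 3) (Fin 3) ℝ),
      Q ∈ Matrix.orthogonalGroup (Fin 3) ℝ →
      ∀ x ∈ K, (fun i : Fin N => Q.mulVec (x (σ⁻¹ i))) ∈ K)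
    (f : (Fin N → Fin 3 → ℝ) → ℝ) (hf : ContinuousOn f K)
    (hfinv : ∀ (σ : Equiv.Perm (Fin N)) (Q : Matrix (Fin 3) (Fin 3) ℝ),
      Q ∈ Matrix.orthogonalGroup (Fin 3) ℝ →
      ∀ x ∈ K, f (fun i : Fin N => Q.mulVec (x (σ⁻¹ i))) = f x)
    (ε : ℝ) (hε : 0 < ε) :
    ∃ p : MvPolynomial (Fin N × Fin 3) ℝ,
      (∀ (σ : Equiv.Perm (Fin N)) (Q : Matrix (Fin 3) (Fin 3) ℝ),
        Q ∈ Matrix.orthogonalGroup (Fin 3) ℝ →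
        ∀ x : Fin N → Fin 3 → ℝ,
          MvPolynomial.eval (fun v : Fin N × Fin 3 => Q.mulVec (x (σ⁻¹ v.1)) v.2) p
            = MvPolynomial.eval (fun v : Fin N × Fin 3 => x v.1 v.2) p) ∧
      ∀ x ∈ K, |f x - MvPolynomial.eval (fun v : Fin N × Fin 3 => x v.1 v.2) p| ≤ ε := by
  have hinv : ∀ x ∈ K, ∀ y ∈ K, (fun v : Fin N × Fin N => x v.1 ⬝ᵥ x v.2) =
      (fun v => y v.1 ⬝ᵥ y v.2) → f x = f y := by
    intro x hx y _ hxy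
    obtain ⟨Q, hQ, hQx⟩ := exists_orthogonal_mulVec_eq_of_dotProduct_eq x y
      fun i j => congrFun hxy (i, j)
    rw [← hfinv 1 Q hQ x hx]
    simp [hQx]
  have hcont : Continuous fun (x : Fin N → Fin 3 → ℝ) (v : Fin N × Fin N) => x v.1 ⬝ᵥ x v.2 := by
    simp only [dotProduct]
    fun_prop
  obtain ⟨F, hF⟩ := hK.exists_continuousMap_factor hcont.continuousOn hf hinv
  obtain ⟨q, hq⟩ := exists_mvPolynomial_near_of_isCompact (hK.image hcont) F hε
  let p : MvPolynomial (Fin N × Fin 3) ℝ :=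
    MvPolynomial.C (Fintype.card (Equiv.Perm (Fin N)) : ℝ)⁻¹ * ∑ τ : Equiv.Perm (Fin N),
      MvPolynomial.bind₁ (fun v : Fin N × Fin N =>
        ∑ a, MvPolynomial.X (τ v.1, a) * MvPolynomial.X (τ v.2, a)) q
  have hp : ∀ x : Fin N → Fin 3 → ℝ, MvPolynomial.eval (fun v => x v.1 v.2) p =
      (Fintype.card (Equiv.Perm (Fin N)) : ℝ)⁻¹ * ∑ τ : Equiv.Perm (Fin N),
        MvPolynomial.eval (fun v => x (τ v.1) ⬝ᵥ x (τ v.2)) q := by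
    intro x
    have hbind : ∀ g : Fin N × Fin N → MvPolynomial (Fin N × Fin 3) ℝ,
        MvPolynomial.eval (fun v => x v.1 v.2) (MvPolynomial.bind₁ g q) =
          MvPolynomial.eval (fun v => MvPolynomial.eval (fun v => x v.1 v.2) (g v)) q :=
      fun g => MvPolynomial.eval₂Hom_bind₁ _ _ _ _
    simp only [p, map_mul, map_sum, MvPolynomial.eval_C, hbind, MvPolynomial.eval_X, dotProduct]
  refine ⟨p, fun σ Q hQ x => ?_, fun x hx => ?_⟩
  · have hdot : ∀ u v : Fin 3 → ℝ, Q.mulVec u ⬝ᵥ Q.mulVec v = u ⬝ᵥ v := by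
      intro u v
      rw [Matrix.dotProduct_mulVec, ← Matrix.mulVec_transpose, Matrix.mulVec_mulVec,
        show Q.transpose * Q = 1 from (Matrix.mem_orthogonalGroup_iff' _ _).1 hQ,
        Matrix.one_mulVec]
    rw [hp (fun i => Q.mulVec (x (σ⁻¹ i))), hp]
    simp only [hdot]
    congr 1
    exact Fintype.sum_equiv (Equiv.mulLeft σ⁻¹) _ _ fun τ => rfl
  · have hτ : ∀ τ : Equiv.Perm (Fin N),
        |f x - MvPolynomial.eval (fun v => x (τ v.1) ⬝ᵥ x (τ v.2)) q| ≤ ε := by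
      intro τ
      have hmem := hKinv τ⁻¹ 1 (one_mem _) x hx
      have hval := hfinv τ⁻¹ 1 (one_mem _) x hx
      simp only [inv_inv, Matrix.one_mulVec] at hmem hval
      rw [← hval, ← hF _ hmem]
      exact hq _
    have hcard : (0 : ℝ) < Fintype.card (Equiv.Perm (Fin N)) := by
      exact_mod_cast Fintype.card_pos
    have havg : f x = (Fintype.card (Equiv.Perm (Fin N)) : ℝ)⁻¹ *
        ∑ _τ : Equiv.Perm (Fin N), f x := by
      rw [Finset.sum_const, nsmul_eq_mul, Finset.card_univ, inv_mul_cancel_left₀ hcard.ne']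
    rw [hp, havg, ← mul_sub,
      ← Finset.sum_sub_distrib, abs_mul, abs_of_pos (inv_pos.2 hcard), inv_mul_le_iff₀ hcard]
    calc _ ≤ ∑ τ : Equiv.Perm (Fin N),
          |f x - MvPolynomial.eval (fun v => x (τ v.1) ⬝ᵥ x (τ v.2)) q| :=
          Finset.abs_sum_le_sum_abs _ _
      _ ≤ ∑ _τ : Equiv.Perm (Fin N), ε := Finset.sum_le_sum fun τ _ => hτ τ
      _ = _ := by rw [Finset.sum_const, nsmul_eq_mul, Finset.card_univ]
end

section
/- Let t ≥ 1 be an integer and f : [0,1] → ℝ be t times continuously differentiable. Let B_n(f) denote the n-th Bernstein polynomial of f, B_n(f)(x) = Σ_{k=0}^{n} f(k/n) · C(n,k) x^k (1−x)^{n−k}. Then B_n(f) converges to f in the C^t norm on [0,1]: for every 0 ≤ s ≤ t, the s-th derivative of B_n(f) converges uniformly on [0,1] to the s-th derivative of f as n → ∞. In particular, for every ε > 0 there exists a polynomial p with max_{0 ≤ s ≤ t} sup_{x∈[0,1]} |f^{(s)}(x) − p^{(s)}(x)| ≤ ε, i.e. polynomials simultaneously approximate a C^t function and all of its derivatives up to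 order t. -/
open scoped BigOperators

/-- The polynomial with coefficients `a 0, …, a n` in the Bernstein basis of degree `n`. -/
noncomputable def bernsteinCombination (n : ℕ) (a : ℕ → ℝ) : Polynomial ℝ :=
  ∑ k ∈ Finset.range (n + 1), a k • bernsteinPolynomial ℝ n k

theorem derivative_bernsteinCombination (n : ℕ) (a : ℕ → ℝ) :
    Polynomial.derivative (bernsteinCombination (n + 1) a) =
      ((n : ℝ) + 1) • bernsteinCombination n (fwdDiff 1 a) := by
  have h_shift : ∑ k ∈ Finset.range (n + 1), a (k + 1) • bernsteinPolynomial ℝ n (k + 1)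
      + a 0 • bernsteinPolynomial ℝ n 0
      = ∑ k ∈ Finset.range (n + 1), a k • bernsteinPolynomial ℝ n k := by
    rw [← Finset.sum_range_succ' (fun k => a k • bernsteinPolynomial ℝ n k),
      Finset.sum_range_succ, bernsteinPolynomial.eq_zero_of_lt ℝ (Nat.lt_succ_self n),
      smul_zero, add_zero]
  have h_deriv (k : ℕ) :
      Polynomial.derivative (a (k + 1) • bernsteinPolynomial ℝ (n + 1) (k + 1)) =
        ((n : ℝ) + 1) • (a (k + 1) • bernsteinPolynomial ℝ n k
          - a (k + 1) • bernsteinPolynomial ℝ n (k + 1)) := by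
    rw [Polynomial.derivative_smul, bernsteinPolynomial.derivative_succ]
    simp only [Polynomial.smul_eq_C_mul, Nat.add_sub_cancel]
    simp
    ring
  have h_deriv_zero : Polynomial.derivative (a 0 • bernsteinPolynomial ℝ (n + 1) 0) =
      -(((n : ℝ) + 1) • (a 0 • bernsteinPolynomial ℝ n 0)) := by
    rw [Polynomial.derivative_smul, bernsteinPolynomial.derivative_zero]
    simp only [Polynomial.smul_eq_C_mul, Nat.add_sub_cancel]
    simp
    ring
  simp only [bernsteinCombination, fwdDiff, sub_smul, Finset.sum_sub_distrib]
  rw [Finset.sum_range_succ', map_add, map_sum, h_deriv_zero, ← h_shift]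
  simp only [h_deriv, ← Finset.smul_sum, Finset.sum_sub_distrib]
  rw [← sub_eq_add_neg, ← smul_sub, sub_add_eq_sub_sub]

theorem iterate_derivative_bernsteinCombination (m s : ℕ) (a : ℕ → ℝ) :
    Polynomial.derivative^[s] (bernsteinCombination (m + s) a) =
      ((m + s).descFactorial s : ℝ) • bernsteinCombination m ((fwdDiff 1)^[s] a) := by
  induction s generalizing a with
  | zero => simp
  | succ s ih =>
    rw [Function.iterate_succ_apply, ← add_assoc, derivative_bernsteinCombination,
      Polynomial.iterate_derivative_smul, ih, Function.iterate_succ_apply,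
      Nat.succ_descFactorial_succ, smul_smul]
    push_cast
    rfl

/-- Mean value theorem for iterated forward differences. -/
theorem exists_fwdDiff_iter_eq (s : ℕ) (F : ℕ → ℝ → ℝ) (a h : ℝ) (hh : 0 < h)
    (hF : ∀ i < s, ∀ x ∈ Set.Icc a (a + s * h),
      HasDerivWithinAt (F i) (F (i + 1) x) (Set.Icc a (a + s * h)) x) :
    ∃ ξ ∈ Set.Icc a (a + s * h), (fwdDiff h)^[s] (F 0) a = h ^ s * F s ξ := by
  induction s generalizing F with
  | zero => exact ⟨a, by simp, by simp⟩
  | succ s ih =>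
    push_cast at hF ⊢
    obtain ⟨ξ, hξ, hξ_eq⟩ := ih (fun i => fwdDiff h (F i)) (by
      intro i hi x hx
      have h1 := hF i (by lia) x ⟨hx.1, by linarith [hx.2]⟩
      have h2 := hF i (by lia) (x + h) ⟨by linarith [hx.1], by linarith [hx.2]⟩
      refine HasDerivWithinAt.sub ?_ (h1.mono (Set.Icc_subset_Icc_right (by linarith)))
      have h3 := h2.scomp x (((hasDerivAt_id x).add_const h).hasDerivWithinAt
        (s := Set.Icc a (a + s * h)))
        (t' := Set.Icc a (a + (s + 1) * h))
        (fun y hy => Set.mem_Icc.2 ⟨by dsimp; linarith [hy.1], by dsimp; linarith [hy.2]⟩)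
      simpa [Function.comp_def] using h3)
    have h_sub : Set.Icc ξ (ξ + h) ⊆ Set.Icc a (a + (s + 1) * h) :=
      Set.Icc_subset_Icc hξ.1 (by linarith [hξ.2])
    obtain ⟨η, hη, hη_eq⟩ := exists_hasDerivAt_eq_slope (F s) (F (s + 1))
      (show ξ < ξ + h by linarith)
      (fun x hx => ((hF s (by lia) x (h_sub hx)).mono h_sub).continuousWithinAt)
      (fun x hx => ((hF s (by lia) x (h_sub (Set.Ioo_subset_Icc_self hx))).mono
        h_sub).hasDerivAt (Icc_mem_nhds hx.1 hx.2))
    refine ⟨η, h_sub (Set.Ioo_subset_Icc_self hη), ?_⟩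
    rw [Function.iterate_succ_apply, hξ_eq, hη_eq]
    simp only [fwdDiff]
    rw [add_sub_cancel_left, pow_succ]
    field_simp

theorem fwdDiff_iter_comp_div (f : ℝ → ℝ) (n : ℝ) (s k : ℕ) :
    (fwdDiff 1)^[s] (fun j : ℕ => f (j / n)) k = (fwdDiff (1 / n))^[s] f (k / n) := by
  rw [fwdDiff_iter_eq_sum_shift, fwdDiff_iter_eq_sum_shift]
  refine Finset.sum_congr rfl fun j _ => ?_
  congr 2
  simp
  ring

theorem eval_bernsteinPolynomial_nonneg (n k : ℕ) {x : ℝ} (hx : x ∈ Set.Icc (0 : ℝ) 1) :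
    0 ≤ (bernsteinPolynomial ℝ n k).eval x :=
  bernstein_nonneg (n := n) (ν := k) (x := ⟨x, hx⟩)

theorem sum_eval_bernsteinPolynomial (n : ℕ) (x : ℝ) :
    ∑ k ∈ Finset.range (n + 1), (bernsteinPolynomial ℝ n k).eval x = 1 := by
  rw [← Polynomial.eval_finsetSum, bernsteinPolynomial.sum, Polynomial.eval_one]

theorem eval_bernsteinCombination (n : ℕ) (a : ℕ → ℝ) (x : ℝ) :
    (bernsteinCombination n a).eval x =
      ∑ k ∈ Finset.range (n + 1), a k * (bernsteinPolynomial ℝ n k).eval x := by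
  simp [bernsteinCombination, Polynomial.eval_finsetSum]

theorem abs_eval_bernsteinCombination_le {n : ℕ} {a : ℕ → ℝ} {M : ℝ}
    (ha : ∀ k ≤ n, |a k| ≤ M) {x : ℝ} (hx : x ∈ Set.Icc (0 : ℝ) 1) :
    |(bernsteinCombination n a).eval x| ≤ M := by
  rw [eval_bernsteinCombination]
  calc _ ≤ ∑ k ∈ Finset.range (n + 1), |a k * (bernsteinPolynomial ℝ n k).eval x| :=
        Finset.abs_sum_le_sum_abs _ _
    _ ≤ ∑ k ∈ Finset.range (n + 1), M * (bernsteinPolynomial ℝ n k).eval x := by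
        refine Finset.sum_le_sum fun k hk => ?_
        have h0 := eval_bernsteinPolynomial_nonneg n k hx
        rw [abs_mul, abs_of_nonneg h0]
        exact mul_le_mul_of_nonneg_right (ha k (by simpa [Nat.lt_succ_iff] using hk)) h0
    _ = M := by rw [← Finset.mul_sum, sum_eval_bernsteinPolynomial, mul_one]

theorem eval_bernsteinCombination_sub (n : ℕ) (a b : ℕ → ℝ) (x : ℝ) :
    (bernsteinCombination n a).eval x - (bernsteinCombination n b).eval x =
      (bernsteinCombination n (a - b)).eval x := by
  simp [eval_bernsteinCombination, sub_mul, Finset.sum_sub_distrib]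

theorem tendstoUniformlyOn_bernsteinCombination {g : ℝ → ℝ}
    (hg : ContinuousOn g (Set.Icc 0 1)) :
    TendstoUniformlyOn (fun (n : ℕ) x => (bernsteinCombination n (fun k => g (k / n))).eval x) g
      Filter.atTop (Set.Icc 0 1) := by
  have h := bernsteinApproximation_uniform
    (⟨(Set.Icc (0 : ℝ) 1).domRestrict g, hg.domRestrict⟩ : C(unitInterval, ℝ))
  rw [ContinuousMap.tendsto_iff_tendstoUniformly, Metric.tendstoUniformly_iff] at h
  rw [Metric.tendstoUniformlyOn_iff]
  intro ε hε
  filter_upwards [h ε hε] with n hn x hx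
  convert hn ⟨x, hx⟩ using 2
  · rfl
  rw [bernsteinApproximation.apply, eval_bernsteinCombination, Finset.sum_range]
  refine Finset.sum_congr rfl fun k _ => ?_
  rw [smul_eq_mul, mul_comm]
  rfl

theorem tendsto_descFactorial_div_pow (s : ℕ) :
    Filter.Tendsto (fun n : ℕ => (n.descFactorial s : ℝ) / (n : ℝ) ^ s) Filter.atTop (nhds 1) := by
  refine (Asymptotics.isEquivalent_iff_tendsto_one ?_).1 (isEquivalent_descFactorial s)
  filter_upwards [Filter.eventually_gt_atTop 0] with n hn
  positivity

/-- The `s`-th derivative of the Bernstein polynomial of degree `m + s` of a `C^s` function `f`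
is, up to a scalar, a Bernstein combination of values of the `s`-th derivative of `f`. -/
theorem exists_iterate_derivative_bernsteinCombination_eq {s : ℕ} {f : ℝ → ℝ}
    (hf : ContDiffOn ℝ s f (Set.Icc 0 1)) {m : ℕ} (hm : 0 < m) :
    ∃ ξ : ℕ → ℝ,
      (∀ k ≤ m, ξ k ∈ Set.Icc (0 : ℝ) 1 ∧ |ξ k - k / m| ≤ s / (m + s : ℕ)) ∧
      ∀ x, (Polynomial.derivative^[s]
          (bernsteinCombination (m + s) (fun k => f (k / (m + s : ℕ))))).eval x =
        ((m + s).descFactorial s : ℝ) / ((m + s : ℕ) : ℝ) ^ s *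
          (bernsteinCombination m
            (fun k => iteratedDerivWithin s f (Set.Icc 0 1) (ξ k))).eval x := by
  have hN : (0 : ℝ) < (m + s : ℕ) := by positivity
  have h_exists (k : ℕ) : ∃ ξ : ℝ, k ≤ m →
      ξ ∈ Set.Icc ((k : ℝ) / (m + s : ℕ)) (k / (m + s : ℕ) + s * (1 / (m + s : ℕ))) ∧
      (fwdDiff 1)^[s] (fun j : ℕ => f (j / (m + s : ℕ))) k =
        (1 / (m + s : ℕ)) ^ s * iteratedDerivWithin s f (Set.Icc 0 1) ξ := by
    by_cases hk : k ≤ m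
    · have h_sub : Set.Icc ((k : ℝ) / (m + s : ℕ)) (k / (m + s : ℕ) + s * (1 / (m + s : ℕ))) ⊆
          Set.Icc 0 1 := by
        refine Set.Icc_subset_Icc (by positivity) ?_
        rw [mul_one_div, ← add_div, div_le_one hN]
        exact_mod_cast Nat.add_le_add_right hk s
      obtain ⟨ξ, hξ, h_eq⟩ := exists_fwdDiff_iter_eq s
        (fun i => iteratedDerivWithin i f (Set.Icc 0 1)) (k / (m + s : ℕ)) (1 / (m + s : ℕ))
        (by positivity) (by
          intro i hi x hx
          have hd := hf.differentiableOn_iteratedDerivWithin (m := i) (by exact_mod_cast hi)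
            (uniqueDiffOn_Icc zero_lt_one) x (h_sub hx)
          simpa only [iteratedDerivWithin_succ] using hd.hasDerivWithinAt.mono h_sub)
      refine ⟨ξ, fun _ => ⟨hξ, ?_⟩⟩
      rw [fwdDiff_iter_comp_div, ← h_eq, iteratedDerivWithin_zero]
    · exact ⟨0, fun h => absurd h hk⟩
  choose ξ hξ using h_exists
  refine ⟨ξ, fun k hk => ?_, fun x => ?_⟩
  · obtain ⟨⟨h1, h2⟩, -⟩ := hξ k hk
    have hk' : (k : ℝ) ≤ m := by exact_mod_cast hk
    have hm' : (0 : ℝ) < m := by exact_mod_cast hm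
    rw [mul_one_div] at h2
    have h3 : (k : ℝ) / (m + s : ℕ) ≤ k / m := by
      gcongr
      simp
    have h4 : (k : ℝ) / m ≤ k / (m + s : ℕ) + s / (m + s : ℕ) := by
      rw [← add_div, div_le_div_iff₀ hm' hN]
      push_cast
      nlinarith [mul_le_mul_of_nonneg_right hk' (Nat.cast_nonneg (α := ℝ) s)]
    have h5 : (k : ℝ) / (m + s : ℕ) + s / (m + s : ℕ) ≤ 1 := by
      rw [← add_div, div_le_one hN]
      exact_mod_cast Nat.add_le_add_right hk s
    have h6 : (0 : ℝ) ≤ k / (m + s : ℕ) := by positivity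
    exact ⟨⟨by linarith, by linarith⟩, abs_le.2 ⟨by linarith, by linarith⟩⟩
  · rw [iterate_derivative_bernsteinCombination, Polynomial.eval_smul, smul_eq_mul,
      eval_bernsteinCombination, eval_bernsteinCombination, Finset.mul_sum, Finset.mul_sum]
    refine Finset.sum_congr rfl fun k hk => ?_
    rw [(hξ k (by simpa [Nat.lt_succ_iff] using hk)).2, one_div, inv_pow]
    ring

theorem tendstoUniformlyOn_iterate_derivative_bernsteinCombination {s : ℕ} {f : ℝ → ℝ}
    (hf : ContDiffOn ℝ s f (Set.Icc 0 1)) :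
    TendstoUniformlyOn
      (fun (n : ℕ) x =>
        (Polynomial.derivative^[s] (bernsteinCombination n (fun k => f (k / n)))).eval x)
      (iteratedDerivWithin s f (Set.Icc 0 1)) Filter.atTop (Set.Icc 0 1) := by
  set g := iteratedDerivWithin s f (Set.Icc 0 1)
  have hg : ContinuousOn g (Set.Icc 0 1) :=
    hf.continuousOn_iteratedDerivWithin le_rfl (uniqueDiffOn_Icc zero_lt_one)
  obtain ⟨M, hM⟩ := isCompact_Icc.exists_bound_of_continuousOn hg
  have h_unif := isCompact_Icc.uniformContinuousOn_of_continuous hg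
  rw [Metric.uniformContinuousOn_iff] at h_unif
  rw [Metric.tendstoUniformlyOn_iff]
  intro ε hε
  obtain ⟨δ, hδ, h_unif⟩ := h_unif (ε / 3) (by positivity)
  have h_approx := Metric.tendstoUniformlyOn_iff.1 (tendstoUniformlyOn_bernsteinCombination hg)
    (ε / 3) (by positivity)
  have h_scalar : ∀ᶠ m : ℕ in Filter.atTop,
      |((m + s).descFactorial s : ℝ) / ((m + s : ℕ) : ℝ) ^ s - 1| * M < ε / 3 := by
    have h := (((tendsto_descFactorial_div_pow s).comp
      (Filter.tendsto_add_atTop_nat s)).sub_const 1).abs.mul_const M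
    rw [sub_self, abs_zero, zero_mul] at h
    exact h.eventually_lt_const (by positivity)
  have h_step : ∀ᶠ m : ℕ in Filter.atTop, (s : ℝ) / (m + s : ℕ) < δ :=
    ((tendsto_const_div_atTop_nhds_zero_nat (s : ℝ)).comp
      (Filter.tendsto_add_atTop_nat s)).eventually_lt_const hδ
  rw [← Filter.map_add_atTop_eq_nat s, Filter.eventually_map]
  filter_upwards [h_approx, h_scalar, h_step, Filter.eventually_gt_atTop 0]
    with m hm_approx hm_scalar hm_step hm x hx
  obtain ⟨ξ, hξ, h_eq⟩ := exists_iterate_derivative_bernsteinCombination_eq hf hm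
  rw [h_eq, Real.dist_eq, abs_sub_comm]
  set c := ((m + s).descFactorial s : ℝ) / ((m + s : ℕ) : ℝ) ^ s
  have h1 : |(bernsteinCombination m (fun k => g (ξ k))).eval x| ≤ M :=
    abs_eval_bernsteinCombination_le (fun k hk => hM _ (hξ k hk).1) hx
  have h2 : |(bernsteinCombination m (fun k => g (ξ k))).eval x
      - (bernsteinCombination m (fun k => g (k / m))).eval x| ≤ ε / 3 := by
    rw [eval_bernsteinCombination_sub]
    refine abs_eval_bernsteinCombination_le (fun k hk => (h_unif _ (hξ k hk).1 _ ?_ ?_).le) hx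
    · exact ⟨by positivity, div_le_one_of_le₀ (by exact_mod_cast hk) (by positivity)⟩
    · exact (hξ k hk).2.trans_lt hm_step
  have h3 := hm_approx x hx
  rw [Real.dist_eq, abs_sub_comm] at h3
  have h4 : |(c - 1) * (bernsteinCombination m (fun k => g (ξ k))).eval x| < ε / 3 := by
    rw [abs_mul]
    exact (mul_le_mul_of_nonneg_left h1 (abs_nonneg _)).trans_lt hm_scalar
  rw [abs_lt] at h3 h4 ⊢
  rw [abs_le] at h2
  constructor <;> linarith [h2.1, h2.2, h3.1, h3.2, h4.1, h4.2]

/-- Bernstein polynomials converge in the `C^t` norm on `[0,1]`: if `f` is `t` times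
continuously differentiable on `[0,1]` (`t ≥ 1`), then for every `0 ≤ s ≤ t` the `s`-th
derivative of the `n`-th Bernstein polynomial
`B_n(f) = ∑_{k=0}^n f(k/n) C(n,k) x^k (1−x)^{n−k}` converges uniformly on `[0,1]` to the
`s`-th derivative of `f`. In particular, polynomials simultaneously approximate a `C^t`
function and all of its derivatives up to order `t`. -/
theorem bernstein_converges_in_Ct (t : ℕ) (ht : 1 ≤ t) (f : ℝ → ℝ)
    (hf : ContDiffOn ℝ t f (Set.Icc 0 1)) :
    (∀ s ≤ t,
      TendstoUniformlyOn
        (fun (n : ℕ) (x : ℝ) =>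
          ((Polynomial.derivative^[s])
              (∑ k ∈ Finset.range (n + 1),
                f ((k : ℝ) / (n : ℝ)) • bernsteinPolynomial ℝ n k)).eval x)
        (fun x => iteratedDerivWithin s f (Set.Icc 0 1) x)
        Filter.atTop (Set.Icc 0 1)) ∧
    ∀ ε : ℝ, 0 < ε → ∃ p : Polynomial ℝ,
      ∀ s ≤ t, ∀ x ∈ Set.Icc (0 : ℝ) 1,
        |iteratedDerivWithin s f (Set.Icc 0 1) x - ((Polynomial.derivative^[s]) p).eval x|
          ≤ ε := by
  have h_tendsto : ∀ s ≤ t,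
      TendstoUniformlyOn
        (fun (n : ℕ) x =>
          (Polynomial.derivative^[s] (bernsteinCombination n (fun k => f (k / n)))).eval x)
        (iteratedDerivWithin s f (Set.Icc 0 1)) Filter.atTop (Set.Icc 0 1) := fun s hs =>
    tendstoUniformlyOn_iterate_derivative_bernsteinCombination
      (hf.of_le (by exact_mod_cast hs))
  refine ⟨h_tendsto, fun ε hε => ?_⟩
  have h_all : ∀ᶠ n : ℕ in Filter.atTop, ∀ s ∈ Set.Iic t, ∀ x ∈ Set.Icc (0 : ℝ) 1,
      dist (iteratedDerivWithin s f (Set.Icc 0 1) x)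
        ((Polynomial.derivative^[s] (bernsteinCombination n (fun k => f (k / n)))).eval x) < ε :=
    (Filter.eventually_all_finite (Set.finite_Iic t)).2 fun s hs =>
      Metric.tendstoUniformlyOn_iff.1 (h_tendsto s hs) ε hε
  obtain ⟨n, hn⟩ := h_all.exists
  exact ⟨bernsteinCombination n (fun k => f (k / n)), fun s hs x hx => (hn s hs x hx).le⟩
end

section
/- Let 0 < r_0 < r_cut and t ≥ 1 an integer. Let Ω̄ = {x ∈ ℝ³ : |x| ≥ r_0} and let f : Ω̄ → ℝ satisfy: f is t times continuously differentiable on Ω̄ and f(x) = 0 whenever |x| ≥ r_cut. Then for every ε > 0 there exist a real polynomial p in the three coordinates of ℝ³ and a C^∞ radial function κ : ℝ³ → ℝ (i.e. κ(x) = g(|x|) for some smooth g), taking values in [0,1] and vanishing for |x| ≥ r_cut, such that ‖f − κ·p‖_{C^t(Ω̄)} ≤ ε, where ‖h‖_{C^t(Ω̄)} := max over multi-indices α with |α| ≤ t of sup_{x∈Ω̄} |∂^α h(x)|. That is, products of a smooth radial cutoff with polynomials, extended by zero, are dense in the C^t functions on Ω̄ supported in the ball of radius r_cut. -/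
open MeasureTheory
section
variable {E : Type*} [NormedAddCommGroup E] [InnerProductSpace ℝ E] [FiniteDimensional ℝ E]
  [MeasurableSpace E] [BorelSpace E]

theorem hasFDerivAt_integral_smul_comp_sub {V : Type*} [NormedAddCommGroup V] [NormedSpace ℝ V]
    [CompleteSpace V] {φ : E → ℝ} (hφ : Continuous φ) {G : E → V} (hGs : HasCompactSupport G)
    (hG : ContDiff ℝ 1 G) (x : E) :
    HasFDerivAt (fun x => ∫ z, φ z • G (x - z)) (∫ z, φ z • fderiv ℝ G (x - z)) x := by
  have := hGs.hasFDerivAt_convolution_right (μ := volume) (ContinuousLinearMap.lsmul ℝ ℝ)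
    hφ.locallyIntegrable hG x
  exact this

theorem iteratedFDeriv_integral_smul_comp_sub {φ : E → ℝ} (hφ : Continuous φ) {F : E → ℝ}
    (hFs : HasCompactSupport F) (n : ℕ) (hF : ContDiff ℝ n F) (x : E) :
    iteratedFDeriv ℝ n (fun x => ∫ z, φ z • F (x - z)) x
      = ∫ z, φ z • iteratedFDeriv ℝ n F (x - z) := by
  induction n generalizing x with
  | zero =>
    simp only [iteratedFDeriv_zero_eq_comp, Function.comp_apply, ← map_smul]
    exact ((continuousMultilinearCurryFin0 ℝ E ℝ).symm.toContinuousLinearEquiv.integral_comp_comm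
      _).symm
  | succ n ih =>
    have hF' : ContDiff ℝ n F := hF.of_le (by exact_mod_cast n.le_succ)
    have hD : ContDiff ℝ 1 (iteratedFDeriv ℝ n F) :=
      hF.iteratedFDeriv_right (by norm_cast; omega)
    rw [iteratedFDeriv_succ_eq_comp_left, Function.comp_apply, funext (ih hF'),
      (hasFDerivAt_integral_smul_comp_sub hφ (hFs.iteratedFDeriv n) hD x).fderiv]
    simp only [iteratedFDeriv_succ_eq_comp_left, Function.comp_apply, ← map_smul]
    exact (ContinuousLinearEquiv.integral_comp_comm (𝕜 := ℝ) (E := E →L[ℝ] E [×n]→L[ℝ] ℝ)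
      (F := E [×n + 1]→L[ℝ] ℝ) (μ := volume)
      (continuousMultilinearCurryLeftEquiv ℝ (fun _ : Fin (n + 1) => E)
      ℝ).symm.toContinuousLinearEquiv fun z => φ z • fderiv ℝ (iteratedFDeriv ℝ n F) (x - z)).symm

theorem MvPolynomial.exists_eval_eq_linear {ι R A : Type*} [CommRing R] [CommRing A] [Algebra R A]
    (L : A →ₗ[R] R) (Q : MvPolynomial ι A) :
    ∃ p : MvPolynomial ι R, ∀ x : ι → R,
      MvPolynomial.eval x p = L (MvPolynomial.eval (fun i => algebraMap R A (x i)) Q) := by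
  refine ⟨∑ d ∈ Q.support, MvPolynomial.monomial d (L (Q.coeff d)), fun x => ?_⟩
  rw [map_sum, MvPolynomial.eval_eq _ Q, map_sum]
  refine Finset.sum_congr rfl fun d _ => ?_
  simp only [← map_pow, ← map_prod]
  rw [mul_comm (Q.coeff d), ← Algebra.smul_def, map_smul, MvPolynomial.eval_monomial, smul_eq_mul,
    mul_comm]
  rfl

theorem exists_mvPolynomial_eval_eq_integral {ι : Type*} [Fintype ι] {R : ℝ}
    {F : EuclideanSpace ℝ ι → ℝ} (hF : Continuous F) (hFs : HasCompactSupport F) (n : ℕ) :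
    ∃ p : MvPolynomial ι ℝ, ∀ x : EuclideanSpace ℝ ι,
      MvPolynomial.eval (fun i => x i) p = ∫ z, (1 - R * ‖z‖ ^ 2) ^ n • F (x - z) := by
  have hgF (g : C(EuclideanSpace ℝ ι, ℝ)) : Integrable (fun y => g y * F y) :=
    (g.continuous.mul hF).integrable_of_hasCompactSupport hFs.mul_left
  let L : C(EuclideanSpace ℝ ι, ℝ) →ₗ[ℝ] ℝ :=
    { toFun := fun g => ∫ y, g y * F y
      map_add' := fun g h => by
        simp only [ContinuousMap.add_apply, add_mul]
        exact integral_add (hgF g) (hgF h)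
      map_smul' := fun c g => by
        simp only [ContinuousMap.smul_apply, smul_eq_mul, mul_assoc, RingHom.id_apply]
        exact integral_const_mul _ _ }
  let coord (i : ι) : C(EuclideanSpace ℝ ι, ℝ) := ⟨fun y => y i, by fun_prop⟩
  obtain ⟨p, hp⟩ := MvPolynomial.exists_eval_eq_linear L
    ((1 - MvPolynomial.C (algebraMap ℝ _ R) *
      ∑ i, (MvPolynomial.X i - MvPolynomial.C (coord i)) ^ 2) ^ n)
  refine ⟨p, fun x => ?_⟩
  rw [hp, ← integral_sub_left_eq_self _ volume x]
  refine integral_congr_ae (Filter.Eventually.of_forall fun y => ?_)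
  simp [EuclideanSpace.norm_sq_eq, coord]

theorem eventually_norm_peak_integral_sub_lt {V : Type*} [NormedAddCommGroup V]
    [NormedSpace ℝ V] [CompleteSpace V] {G : E → V} (hG : Continuous G) {r : ℝ} (hr : 0 < r)
    (hGz : ∀ x, r < ‖x‖ → G x = 0) {η : ℝ} (hη : 0 < η) :
    ∀ᶠ n : ℕ in Filter.atTop, ∀ x ∈ Metric.closedBall (0 : E) r,
      ‖(∫ z in Metric.closedBall (0 : E) (2 * r), (1 - (4 * r ^ 2)⁻¹ * ‖z‖ ^ 2) ^ n)⁻¹ •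
        (∫ z, (1 - (4 * r ^ 2)⁻¹ * ‖z‖ ^ 2) ^ n • G (x - z)) - G x‖ < η := by
  set s := Metric.closedBall (0 : E) (2 * r)
  set φ : E → ℝ := fun z => 1 - (4 * r ^ 2)⁻¹ * ‖z‖ ^ 2 with hφ_def
  have hφ : Continuous φ := by fun_prop
  let K := Metric.closedBall (0 : E) r
  have : CompactSpace K := isCompact_iff_compactSpace.1 (isCompact_closedBall _ _)
  let g : C(E, C(K, V)) := ContinuousMap.curry ⟨fun p : E × K => G (p.2 - p.1), by fun_prop⟩
  have hs : IsCompact s := isCompact_closedBall _ _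
  have key := tendsto_setIntegral_pow_smul_of_unique_maximum_of_isCompact_of_continuousOn
    (μ := volume) (x₀ := (0 : E)) (g := g) hs hφ.continuousOn
    (fun y _ hy => by
      have : 0 < (4 * r ^ 2)⁻¹ * ‖y‖ ^ 2 := by positivity
      simpa [hφ_def] using this)
    (fun y hy => by
      have hy' : ‖y‖ ≤ 2 * r := by simpa [s] using hy
      have : ‖y‖ ^ 2 ≤ 4 * r ^ 2 := by nlinarith [norm_nonneg y]
      have := inv_mul_le_one_of_le₀ this (by positivity)
      simpa [hφ_def] using this)
    (by simp [hφ_def])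
    (subset_closure (mem_interior_iff_mem_nhds.2 (Metric.closedBall_mem_nhds _ (by positivity))))
    g.continuous.continuousOn
  filter_upwards [(Metric.tendsto_nhds.1 key) η hη] with n hn x hx
  rw [dist_eq_norm] at hn
  have hcont : Continuous fun z => φ z ^ n • g z := by fun_prop
  have heval : (∫ z in s, φ z ^ n • g z) ⟨x, hx⟩ = ∫ z, φ z ^ n • G (x - z) := by
    have := (ContinuousMap.evalCLM ℝ (⟨x, hx⟩ : K)).integral_comp_comm
      (hcont.continuousOn.integrableOn_compact (μ := volume) hs)
    refine this.symm.trans ?_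
    refine setIntegral_eq_integral_of_forall_compl_eq_zero fun z hz => ?_
    have hz' : 2 * r < ‖z‖ := by simpa [s] using hz
    have hx' : ‖x‖ ≤ r := by simpa using hx
    have : G (x - z) = 0 := hGz _ (by linarith [norm_sub_norm_le z x, norm_sub_rev z x])
    change φ z ^ n • G (x - z) = 0
    rw [this, smul_zero]
  refine lt_of_le_of_lt ?_ hn
  have := ContinuousMap.norm_coe_le_norm
    ((∫ z in s, φ z ^ n)⁻¹ • (∫ z in s, φ z ^ n • g z) - g 0) ⟨x, hx⟩
  have hg0 : g 0 ⟨x, hx⟩ = G x := by simp [g]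
  rwa [ContinuousMap.sub_apply, ContinuousMap.smul_apply, heval, hg0] at this

theorem MvPolynomial.contDiff_eval {ι : Type*} [Fintype ι] (p : MvPolynomial ι ℝ)
    {n : WithTop ℕ∞} :
    ContDiff ℝ n fun x : EuclideanSpace ℝ ι => MvPolynomial.eval (fun i => x i) p := by
  simp only [MvPolynomial.eval_eq']
  fun_prop

theorem exists_mvPolynomial_iteratedFDeriv_sub_lt {ι : Type*} [Fintype ι]
    {F : EuclideanSpace ℝ ι → ℝ} {t : ℕ} (hF : ContDiff ℝ t F) {r : ℝ} (hr : 0 < r)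
    (hFz : ∀ x, r < ‖x‖ → F x = 0) {η : ℝ} (hη : 0 < η) :
    ∃ p : MvPolynomial ι ℝ, ∀ m ≤ t, ∀ x ∈ Metric.closedBall (0 : EuclideanSpace ℝ ι) r,
      ‖iteratedFDeriv ℝ m (fun y => F y - MvPolynomial.eval (fun i => y i) p) x‖ < η := by
  have hts : tsupport F ⊆ Metric.closedBall 0 r := by
    refine closure_minimal (fun x hx => ?_) Metric.isClosed_closedBall
    by_contra h
    exact hx (hFz x (by simpa using h))
  have hFs : HasCompactSupport F :=
    (isCompact_closedBall _ _).of_isClosed_subset (isClosed_tsupport F) hts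
  have hlim : ∀ᶠ n : ℕ in Filter.atTop, ∀ m ∈ Finset.range (t + 1),
      ∀ x ∈ Metric.closedBall (0 : EuclideanSpace ℝ ι) r,
      ‖(∫ z in Metric.closedBall (0 : EuclideanSpace ℝ ι) (2 * r),
          (1 - (4 * r ^ 2)⁻¹ * ‖z‖ ^ 2) ^ n)⁻¹ •
        (∫ z, (1 - (4 * r ^ 2)⁻¹ * ‖z‖ ^ 2) ^ n • iteratedFDeriv ℝ m F (x - z))
          - iteratedFDeriv ℝ m F x‖ < η := by
    rw [Filter.eventually_all_finset]
    intro m hm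
    have hm' : m ≤ t := by simpa [Nat.lt_succ_iff] using hm
    refine eventually_norm_peak_integral_sub_lt (hF.continuous_iteratedFDeriv
      (by exact_mod_cast hm')) hr (fun x hx => ?_) hη
    by_contra h
    have := hts (support_iteratedFDeriv_subset m h)
    simp at this
    linarith
  obtain ⟨n, hn⟩ := hlim.exists
  set a := (∫ z in Metric.closedBall (0 : EuclideanSpace ℝ ι) (2 * r),
    (1 - (4 * r ^ 2)⁻¹ * ‖z‖ ^ 2) ^ n)⁻¹
  obtain ⟨q, hq⟩ := exists_mvPolynomial_eval_eq_integral (R := (4 * r ^ 2)⁻¹) hF.continuous hFs n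
  refine ⟨MvPolynomial.C a * q, fun m hm x hx => ?_⟩
  have hFm : ContDiff ℝ m F := hF.of_le (by exact_mod_cast hm)
  have hqD : iteratedFDeriv ℝ m (fun y : EuclideanSpace ℝ ι =>
      MvPolynomial.eval (fun i => y i) (MvPolynomial.C a * q)) x =
      a • ∫ z, (1 - (4 * r ^ 2)⁻¹ * ‖z‖ ^ 2) ^ n • iteratedFDeriv ℝ m F (x - z) := by
    have : (fun y : EuclideanSpace ℝ ι => MvPolynomial.eval (fun i => y i) (MvPolynomial.C a * q))
        = fun y => a • MvPolynomial.eval (fun i => y i) q := by ext; simp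
    rw [this, iteratedFDeriv_const_smul_apply' q.contDiff_eval.contDiffAt, funext hq,
      iteratedFDeriv_integral_smul_comp_sub (by fun_prop) hFs m hFm]
  rw [fun_iteratedFDeriv_sub_apply hFm.contDiffAt
    (MvPolynomial.contDiff_eval _).contDiffAt, hqD, norm_sub_rev]
  exact hn m (by simpa [Nat.lt_succ_iff] using hm) x hx

end

section
variable {E : Type*} [NormedAddCommGroup E]

/-- A smooth radial cutoff equal to `1` for `‖x‖ ≤ a` and to `0` for `b ≤ ‖x‖`. -/
noncomputable def radialCutoff (a b : ℝ) (x : E) : ℝ :=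
  Real.smoothTransition ((b ^ 2 - ‖x‖ ^ 2) / (b ^ 2 - a ^ 2))

theorem radialCutoff_eq_one {a b : ℝ} (ha : 0 ≤ a) (hab : a < b) {x : E} (hx : ‖x‖ ≤ a) :
    radialCutoff a b x = 1 := by
  refine Real.smoothTransition.one_of_one_le ?_
  rw [one_le_div (by nlinarith)]
  nlinarith [norm_nonneg x]

theorem radialCutoff_eq_zero {a b : ℝ} (ha : 0 ≤ a) (hab : a < b) {x : E} (hx : b ≤ ‖x‖) :
    radialCutoff a b x = 0 := by
  refine Real.smoothTransition.zero_of_nonpos (div_nonpos_of_nonpos_of_nonneg ?_ ?_) <;>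
  nlinarith

variable [InnerProductSpace ℝ E]

theorem contDiff_radialCutoff (a b : ℝ) {n : ℕ∞} :
    ContDiff ℝ n (radialCutoff a b : E → ℝ) :=
  Real.smoothTransition.contDiff.comp
    ((contDiff_const.sub (contDiff_norm_sq ℝ)).div_const _)


theorem uniqueDiffOn_setOf_le_norm {r : ℝ} (hr : 0 < r) : UniqueDiffOn ℝ {x : E | r ≤ ‖x‖} := by
  intro x hx
  have hx0 : 0 < ‖x‖ := hr.trans_le hx
  let H : Set E := {y | r * ‖x‖ ≤ inner ℝ x y}
  have hH : Convex ℝ H := convex_halfSpace_ge (innerSL ℝ x).isLinear _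
  have hHi : (interior H).Nonempty := by
    have hsub : {y : E | r * ‖x‖ < inner ℝ x y} ⊆ H := fun y hy =>
      show r * ‖x‖ ≤ inner ℝ x y from le_of_lt hy
    refine ⟨(2 : ℝ) • x, interior_maximal hsub (isOpen_lt (by fun_prop) (by fun_prop)) ?_⟩
    simp only [Set.mem_ofPred_eq, inner_smul_right, real_inner_self_eq_norm_sq] at hx ⊢
    nlinarith
  have hxH : x ∈ H := by
    simp only [H, Set.mem_ofPred_eq, real_inner_self_eq_norm_sq] at hx ⊢
    nlinarith
  refine (uniqueDiffOn_convex hH hHi x hxH).mono fun y hy => ?_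
  exact le_of_mul_le_mul_left ((mul_comm _ _).trans_le (hy.trans (real_inner_le_norm x y))) hx0

theorem iteratedFDerivWithin_comp_smul_of_one_le {f : E → ℝ} {r : ℝ} (hr : 0 < r) {m : ℕ}
    (hf : ContDiffOn ℝ m f {x : E | r ≤ ‖x‖}) {c : ℝ} (hc : 1 ≤ c) {x : E} (hx : r ≤ ‖x‖) :
    iteratedFDerivWithin ℝ m (fun y => f (c • y)) {x : E | r ≤ ‖x‖} x =
      c ^ m • iteratedFDerivWithin ℝ m f {x : E | r ≤ ‖x‖} (c • x) := by
  have hc0 : 0 < c := by linarith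
  let g : E →L[ℝ] E := c • ContinuousLinearMap.id ℝ E
  have hpre : g ⁻¹' {x : E | r ≤ ‖x‖} = {x : E | r / c ≤ ‖x‖} := by
    ext y
    simp [g, norm_smul, abs_of_pos hc0, div_le_iff₀' hc0]
  have hsub : {x : E | r ≤ ‖x‖} ⊆ g ⁻¹' {x : E | r ≤ ‖x‖} := by
    rw [hpre]
    exact fun y hy => (div_le_self hr.le hc).trans hy
  have hpu : UniqueDiffOn ℝ (g ⁻¹' {x : E | r ≤ ‖x‖}) := by
    rw [hpre]
    exact uniqueDiffOn_setOf_le_norm (by positivity)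
  have hu := uniqueDiffOn_setOf_le_norm (E := E) hr
  have h1 := iteratedFDerivWithin_subset hsub hu hpu (hf.comp_continuousLinearMap g) hx
  have h2 := g.iteratedFDerivWithin_comp_right hf hu hpu (hsub hx) le_rfl
  refine h1.trans (h2.trans ?_)
  ext v
  simp [g, ContinuousMultilinearMap.map_smul_univ]

theorem iteratedFDerivWithin_eq_zero_of_eq_zero {f : E → ℝ} {R : ℝ}
    (hf : ∀ x, R ≤ ‖x‖ → f x = 0) {x : E} (hx : R < ‖x‖) (s : Set E) (m : ℕ) :
    iteratedFDerivWithin ℝ m f s x = 0 := by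
  have hU : ∀ᶠ y in nhds x, R < ‖y‖ := (isOpen_lt continuous_const continuous_norm).mem_nhds hx
  have : f =ᶠ[nhdsWithin x s] 0 :=
    (hU.filter_mono nhdsWithin_le_nhds).mono fun y hy => hf y (le_of_lt hy)
  rw [this.iteratedFDerivWithin_eq (hf x hx.le)]
  simp

variable [FiniteDimensional ℝ E]

theorem eventually_norm_iteratedFDerivWithin_sub_comp_smul_lt {f : E → ℝ} {r R : ℝ} (hr : 0 < r)
    {m : ℕ} (hf : ContDiffOn ℝ m f {x : E | r ≤ ‖x‖}) (hfz : ∀ x, R ≤ ‖x‖ → f x = 0)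
    {η : ℝ} (hη : 0 < η) :
    ∀ᶠ c in nhdsWithin (1 : ℝ) (Set.Ioi 1), ∀ x : E, r ≤ ‖x‖ →
      ‖iteratedFDerivWithin ℝ m (fun y => f y - f (c • y)) {x : E | r ≤ ‖x‖} x‖ < η := by
  set S := {x : E | r ≤ ‖x‖}
  have hu : UniqueDiffOn ℝ S := uniqueDiffOn_setOf_le_norm hr
  have le_norm_smul {c : ℝ} (hc : 1 ≤ c) (x : E) : ‖x‖ ≤ ‖c • x‖ := by
    rw [norm_smul, Real.norm_of_nonneg (by linarith)]
    exact le_mul_of_one_le_left (norm_nonneg x) hc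
  let A : Set E := S ∩ Metric.closedBall 0 R
  have hA : IsCompact A := (isCompact_closedBall _ _).inter_left
    (isClosed_le continuous_const continuous_norm)
  let H : ℝ × E → E [×m]→L[ℝ] ℝ := fun q => q.1 ^ m • iteratedFDerivWithin ℝ m f S (q.1 • q.2)
  have hH : ContinuousOn H (Set.Icc 1 2 ×ˢ A) := by
    have hmap : Set.MapsTo (fun q : ℝ × E => q.1 • q.2) (Set.Icc 1 2 ×ˢ A) S :=
      fun q hq => le_trans (show r ≤ ‖q.2‖ from hq.2.1) (le_norm_smul hq.1.1 q.2)
    have hsmul : ContinuousOn (fun q : ℝ × E => q.1 • q.2) (Set.Icc 1 2 ×ˢ A) := by fun_prop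
    have hpow : ContinuousOn (fun q : ℝ × E => q.1 ^ m) (Set.Icc 1 2 ×ˢ A) := by fun_prop
    exact hpow.smul ((hf.continuousOn_iteratedFDerivWithin le_rfl hu).comp hsmul hmap)
  have hUC := (isCompact_Icc.prod hA).uniformContinuousOn_of_continuous hH
  obtain ⟨δ, hδ, hUCδ⟩ := Metric.uniformContinuousOn_iff.1 hUC η hη
  have hlt : ∀ᶠ c in nhdsWithin (1 : ℝ) (Set.Ioi 1), c < min 2 (1 + δ) :=
    nhdsWithin_le_nhds (Iio_mem_nhds (by simp [hδ]))
  filter_upwards [hlt, self_mem_nhdsWithin] with c hc (hc1 : 1 < c) x hx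
  obtain ⟨hc2, hcδ⟩ := lt_min_iff.1 hc
  have hcomp : ContDiffOn ℝ m (fun y => f (c • y)) S :=
    hf.comp (by fun_prop) fun y hy => le_trans (show r ≤ ‖y‖ from hy) (le_norm_smul hc1.le y)
  rcases lt_or_ge R ‖x‖ with hxR | hxR
  · rw [iteratedFDerivWithin_eq_zero_of_eq_zero (fun y hy => ?_) hxR, norm_zero]
    · exact hη
    · rw [hfz y hy, hfz _ (hy.trans (le_norm_smul hc1.le y)), sub_zero]
  · rw [fun_iteratedFDerivWithin_sub_apply (hf x hx) (hcomp x hx) hu hx,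
      iteratedFDerivWithin_comp_smul_of_one_le hr hf hc1.le hx, ← dist_eq_norm]
    have hxA : x ∈ A := ⟨hx, by simpa using hxR⟩
    have := hUCδ (1, x) ⟨⟨le_rfl, one_le_two⟩, hxA⟩ (c, x) ⟨⟨hc1.le, hc2.le⟩, hxA⟩
      (by rw [Prod.dist_eq]; simp [Real.dist_eq, abs_sub_lt_iff]; constructor <;> linarith)
    simpa [H] using this
end

theorem norm_iteratedFDeriv_mul_le_of_forall_le {E : Type*} [NormedAddCommGroup E]
    [NormedSpace ℝ E] {f g : E → ℝ} {m : ℕ} (hf : ContDiff ℝ m f) (hg : ContDiff ℝ m g) {x : E}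
    {M η : ℝ} (hM : ∀ i ≤ m, ‖iteratedFDeriv ℝ i f x‖ ≤ M)
    (hη : ∀ i ≤ m, ‖iteratedFDeriv ℝ i g x‖ ≤ η) :
    ‖iteratedFDeriv ℝ m (fun y => f y * g y) x‖ ≤ 2 ^ m * (M * η) := by
  have hM0 : 0 ≤ M := (norm_nonneg _).trans (hM 0 m.zero_le)
  refine (norm_iteratedFDeriv_mul_le hf hg x le_rfl).trans ?_
  have hsum : ∑ i ∈ Finset.range (m + 1), (m.choose i : ℝ) = 2 ^ m := by
    exact_mod_cast Nat.sum_range_choose m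
  rw [← hsum, Finset.sum_mul]
  refine Finset.sum_le_sum fun i hi => ?_
  rw [mul_assoc]
  gcongr
  · exact hM i (Nat.lt_succ_iff.1 (Finset.mem_range.1 hi))
  · exact hη (m - i) (Nat.sub_le m i)

theorem contDiff_one_sub_radialCutoff_mul_comp_smul {E : Type*} [NormedAddCommGroup E]
    [InnerProductSpace ℝ E] {f : E → ℝ} {r r' c : ℝ} {t : ℕ}
    (hf : ContDiffOn ℝ t f {x : E | r ≤ ‖x‖}) (hr' : 0 ≤ r') (hr : r' < r) (hc : r < c * r') :
    ContDiff ℝ t fun x => (1 - radialCutoff r' r x) * f (c • x) := by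
  have hc0 : 0 < c := by
    by_contra! h
    nlinarith [mul_nonneg (neg_nonneg.2 h) hr']
  rw [contDiff_iff_contDiffAt]
  intro x
  rcases lt_or_ge ‖x‖ r' with hx | hx
  · have hU : ∀ᶠ y in nhds x, ‖y‖ < r' :=
      (isOpen_lt continuous_norm continuous_const).mem_nhds hx
    refine (contDiffAt_const (c := (0 : ℝ))).congr_of_eventuallyEq (hU.mono fun y hy => ?_)
    simp [radialCutoff_eq_one hr' hr (le_of_lt hy)]
  · refine (contDiffAt_const.sub
      ((contDiff_radialCutoff r' r (n := (t : ℕ∞))).contDiffAt.of_le le_rfl)).mul ?_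
    have hcx : r < ‖c • x‖ := by
      rw [norm_smul, Real.norm_of_nonneg hc0.le]
      nlinarith
    have : {x : E | r ≤ ‖x‖} ∈ nhds (c • x) := Filter.mem_of_superset
      ((isOpen_lt continuous_const continuous_norm).mem_nhds hcx) fun y hy => le_of_lt (show r < ‖y‖ from hy)
    exact (hf.contDiffAt this).comp x (by fun_prop)

/-- Products of a smooth radial cutoff with polynomials are dense in the `C^t` functions on
the exterior domain `Ω̄ = {x ∈ ℝ³ : |x| ≥ r₀}` supported in the ball of radius `r_cut`:
for every such `f` and every `ε > 0` there are a polynomial `p` in the three coordinates and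
a `C^∞` radial function `κ` with values in `[0,1]` vanishing for `|x| ≥ r_cut` such that all
partial derivatives of `f − κ·p` up to order `t` are bounded by `ε` on `Ω̄`. -/
theorem cutoff_times_polynomial_dense (r0 rcut : ℝ) (h0 : 0 < r0) (hr : r0 < rcut)
    (t : ℕ) (ht : 1 ≤ t)
    (f : EuclideanSpace ℝ (Fin 3) → ℝ)
    (hf : ContDiffOn ℝ t f {x : EuclideanSpace ℝ (Fin 3) | r0 ≤ ‖x‖})
    (hfz : ∀ x : EuclideanSpace ℝ (Fin 3), rcut ≤ ‖x‖ → f x = 0)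
    (ε : ℝ) (hε : 0 < ε) :
    ∃ (p : MvPolynomial (Fin 3) ℝ) (κ : EuclideanSpace ℝ (Fin 3) → ℝ),
      ContDiff ℝ (⊤ : ℕ∞) κ ∧
      (∃ g : ℝ → ℝ, ∀ x, κ x = g ‖x‖) ∧
      (∀ x, κ x ∈ Set.Icc (0 : ℝ) 1) ∧
      (∀ x : EuclideanSpace ℝ (Fin 3), rcut ≤ ‖x‖ → κ x = 0) ∧
      ∀ m ≤ t, ∀ d : Fin m → Fin 3,
        ∀ x ∈ {x : EuclideanSpace ℝ (Fin 3) | r0 ≤ ‖x‖},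
          |(iteratedFDerivWithin ℝ m
              (fun y => f y - κ y * MvPolynomial.eval (fun i => y i) p)
              {x : EuclideanSpace ℝ (Fin 3) | r0 ≤ ‖x‖} x)
              (fun j => EuclideanSpace.single (d j) (1 : ℝ))| ≤ ε := by
  have hrcut : 0 < rcut := h0.trans hr
  have hdil : ∀ᶠ c in nhdsWithin (1 : ℝ) (Set.Ioi 1), ∀ m ∈ Finset.range (t + 1),
      ∀ x : EuclideanSpace ℝ (Fin 3), r0 ≤ ‖x‖ →
      ‖iteratedFDerivWithin ℝ m (fun y => f y - f (c • y)) {x | r0 ≤ ‖x‖} x‖ < ε / 2 := by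
    rw [Filter.eventually_all_finset]
    intro m hm
    have hm' : m ≤ t := Nat.lt_succ_iff.1 (Finset.mem_range.1 hm)
    exact eventually_norm_iteratedFDerivWithin_sub_comp_smul_lt h0
      (hf.of_le (by exact_mod_cast hm')) hfz (half_pos hε)
  obtain ⟨c, hdc, hc : 1 < c⟩ := (hdil.and self_mem_nhdsWithin).exists
  have hc0 : 0 < c := by linarith
  obtain ⟨r1, hr1, hr1'⟩ := exists_between (div_lt_self h0 hc)
  have hr1pos : 0 < r1 := (by positivity : 0 < r0 / c).trans hr1
  have ha : rcut / c < rcut := div_lt_self hrcut hc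
  have ha0 : 0 < rcut / c := by positivity
  set F : EuclideanSpace ℝ (Fin 3) → ℝ := fun x => (1 - radialCutoff r1 r0 x) * f (c • x)
  have hF : ContDiff ℝ t F :=
    contDiff_one_sub_radialCutoff_mul_comp_smul hf hr1pos.le hr1' ((div_lt_iff₀' hc0).1 hr1)
  have hfc (x : EuclideanSpace ℝ (Fin 3)) (hx : rcut / c ≤ ‖x‖) : f (c • x) = 0 := by
    refine hfz _ ?_
    rw [norm_smul, Real.norm_of_nonneg hc0.le]
    exact (div_le_iff₀' hc0).1 hx
  have hFz (x : EuclideanSpace ℝ (Fin 3)) (hx : rcut < ‖x‖) : F x = 0 := by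
    simp [F, hfc x (ha.trans hx).le]
  set κ : EuclideanSpace ℝ (Fin 3) → ℝ := radialCutoff (rcut / c) rcut
  have hκ {n : ℕ∞} : ContDiff ℝ n κ := contDiff_radialCutoff _ _
  have hκz (x : EuclideanSpace ℝ (Fin 3)) (hx : rcut ≤ ‖x‖) : κ x = 0 :=
    radialCutoff_eq_zero ha0.le ha hx
  obtain ⟨M, hM0, hM⟩ : ∃ M, 0 < M ∧ ∀ i ≤ t,
      ∀ x ∈ Metric.closedBall 0 rcut, ‖iteratedFDeriv ℝ i κ x‖ ≤ M := by
    have (i : ℕ) := (isCompact_closedBall (0 : EuclideanSpace ℝ (Fin 3))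
      rcut).exists_bound_of_continuousOn ((hκ (n := (i : ℕ∞))).continuous_iteratedFDeriv le_rfl).continuousOn
    choose B hB using this
    refine ⟨1 + ∑ i ∈ Finset.range (t + 1), |B i|, by positivity, fun i hi x hx => ?_⟩
    have := Finset.single_le_sum (f := fun i => |B i|) (fun j _ => abs_nonneg _)
      (Finset.mem_range.2 (Nat.lt_succ_iff.2 hi))
    linarith [hB i x hx, le_abs_self (B i)]
  obtain ⟨p, hp⟩ := exists_mvPolynomial_iteratedFDeriv_sub_lt hF hrcut hFz
    (η := ε / 2 / (2 ^ t * M)) (by positivity)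
  refine ⟨p, κ, hκ, ⟨fun s => Real.smoothTransition ((rcut ^ 2 - s ^ 2) /
    (rcut ^ 2 - (rcut / c) ^ 2)), fun x => rfl⟩,
    fun x => ⟨Real.smoothTransition.nonneg _, Real.smoothTransition.le_one _⟩, hκz, ?_⟩
  intro m hm d x (hx : r0 ≤ ‖x‖)
  set S := {x : EuclideanSpace ℝ (Fin 3) | r0 ≤ ‖x‖}
  have hS : UniqueDiffOn ℝ S := uniqueDiffOn_setOf_le_norm h0
  refine (Real.norm_eq_abs _).symm.trans_le ((ContinuousMultilinearMap.le_opNorm _ _).trans ?_)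
  simp only [PiLp.norm_single, norm_one, Finset.prod_const_one, mul_one]
  rcases lt_or_ge rcut ‖x‖ with hxr | hxr
  · rw [iteratedFDerivWithin_eq_zero_of_eq_zero
      (fun y hy => by rw [hfz y hy, hκz y hy, zero_mul, sub_zero]) hxr, norm_zero]
    exact hε.le
  have hsplit : Set.EqOn (fun y => f y - κ y * MvPolynomial.eval (fun i => y i) p)
      (fun y => (f y - f (c • y)) + κ y * (F y - MvPolynomial.eval (fun i => y i) p)) S := by
    intro y hy
    have h1 : F y = f (c • y) := by simp [F, radialCutoff_eq_zero hr1pos.le hr1' hy]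
    have h2 : κ y * f (c • y) = f (c • y) := by
      rcases le_total ‖y‖ (rcut / c) with h | h
      · rw [show κ y = 1 from radialCutoff_eq_one ha0.le ha h, one_mul]
      · rw [hfc y h, mul_zero]
    simp only [h1, mul_sub, h2]
    ring
  have hmt : (m : WithTop ℕ∞) ≤ t := by exact_mod_cast hm
  have hmaps : Set.MapsTo (fun y : EuclideanSpace ℝ (Fin 3) => c • y) S S := by
    intro y hy
    change r0 ≤ ‖c • y‖
    rw [norm_smul, Real.norm_of_nonneg hc0.le]
    exact le_trans hy (le_mul_of_one_le_left (norm_nonneg y) hc.le)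
  have hdiff : ContDiffOn ℝ m (fun y => f y - f (c • y)) S :=
    (hf.of_le hmt).sub ((hf.of_le hmt).comp (by fun_prop) hmaps)
  have hFp : ContDiff ℝ m fun y => F y - MvPolynomial.eval (fun i => y i) p :=
    (hF.of_le hmt).sub p.contDiff_eval
  have hκm : ContDiff ℝ m κ := hκ (n := (m : ℕ∞))
  have hprod := hκm.mul hFp
  rw [iteratedFDerivWithin_congr hsplit hx, fun_iteratedFDerivWithin_add_apply (hdiff x hx)
    hprod.contDiffAt.contDiffWithinAt hS hx,
    iteratedFDerivWithin_eq_iteratedFDeriv hS hprod.contDiffAt hx]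
  have hxball : x ∈ Metric.closedBall (0 : EuclideanSpace ℝ (Fin 3)) rcut := by simpa using hxr
  have hbound := norm_iteratedFDeriv_mul_le_of_forall_le hκm hFp
    (fun i hi => hM i (hi.trans hm) x hxball) (fun i hi => (hp i (hi.trans hm) x hxball).le)
  have hpow : (2 : ℝ) ^ m * (M * (ε / 2 / (2 ^ t * M))) ≤ ε / 2 := by
    have : (2 : ℝ) ^ m ≤ 2 ^ t := pow_le_pow_right₀ one_le_two hm
    calc (2 : ℝ) ^ m * (M * (ε / 2 / (2 ^ t * M)))
        ≤ 2 ^ t * (M * (ε / 2 / (2 ^ t * M))) := by gcongr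
      _ = ε / 2 := by field_simp
  have hdil' := hdc m (Finset.mem_range.2 (Nat.lt_succ_iff.2 hm)) x hx
  linarith [norm_add_le (iteratedFDerivWithin ℝ m (fun y => f y - f (c • y)) S x)
    (iteratedFDeriv ℝ m (fun y => κ y * (F y - MvPolynomial.eval (fun i => y i) p)) x)]
end

section
/- Let 0 ≤ r_0 < r_cut, let t ≥ 1 be an integer, let ξ : [r_0, r_cut] → [a, b] be a C^∞ bijection with C^∞ inverse, and let f_cut : [r_0, ∞) → ℝ be t times continuously differentiable with f_cut > 0 on [r_0, r_cut) and f_cut = 0 on [r_cut, ∞). Let ρ be a finite Borel measure on [r_0, r_cut], and suppose (J_n)_{n∈ℕ} is a sequence of real polynomials with deg J_n = n satisfying the orthonormality ∫_{r_0}^{r_cut} J_n(ξ(r)) J_m(ξ(r)) f_cut(r)² ρ(dr) = δ_{nm}. Define P_n(r) := J_n(ξ(r)) · f_cut(r) for r ∈ [r_0, r_cut] and P_n(r) := 0 for r ≥ r_cut. Then: (i) each P_n is t times continuously differentiable on [r_0, ∞) and vanishes on [r_cut, ∞); (ii) the P_n are orthonormal in L²(ρ): ∫_{r_0}^{r_cut}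 P_n(r) P_m(r) ρ(dr) = δ_{nm}; (iii) the family (P_n) is linearly independent; and (iv) for every f : [r_0, ∞) → ℝ that is t times continuously differentiable and vanishes on [r_cut, ∞), and every ε > 0, there is a finite linear combination q of the P_n with max over 0 ≤ s ≤ t of sup_{r ≥ r_0} |f^{(s)}(r) − q^{(s)}(r)| ≤ ε; i.e. span{P_n} is dense in the C^t functions on [r_0, ∞) supported in [r_0, r_cut]. -/
open MeasureTheory

/-- A `C^n` function on a closed convex subset of the line with nonempty interior extends to a
`C^n` function on the whole line. -/
theorem ContDiffOn.exists_contDiff_extension {s : Set ℝ} (hs : IsClosed s) (hconv : Convex ℝ s)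
    (hs_int : (interior s).Nonempty) (n : ℕ) {f : ℝ → ℝ} (hf : ContDiffOn ℝ n f s) :
    ∃ F : ℝ → ℝ, ContDiff ℝ n F ∧ Set.EqOn F f s := by
  induction n generalizing f with
  | zero =>
    obtain ⟨g, hg⟩ := ContinuousMap.exists_restrict_eq hs
      ⟨s.domRestrict f, continuousOn_iff_continuous_domRestrict.mp hf.continuousOn⟩
    refine ⟨g, by simpa using g.continuous, fun x hx => ?_⟩
    exact congrArg (fun k : C(s, ℝ) => k ⟨x, hx⟩) hg
  | succ n ih =>
    have hu : UniqueDiffOn ℝ s := uniqueDiffOn_convex hconv hs_int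
    push_cast at hf ⊢
    obtain ⟨hd, -, hf'⟩ := (contDiffOn_succ_iff_derivWithin hu).1 hf
    obtain ⟨G, hG, hGf⟩ := ih hf'
    obtain ⟨x₀, hx₀⟩ := hs_int.mono interior_subset
    have hder : ∀ x, HasDerivAt (fun x => f x₀ + ∫ y in x₀..x, G y) (G x) x := fun x =>
      (hG.continuous.integral_hasStrictDerivAt x₀ x).hasDerivAt.const_add (f x₀)
    refine ⟨fun x => f x₀ + ∫ y in x₀..x, G y, ?_, fun x hx => ?_⟩
    · refine contDiff_succ_iff_deriv.2 ⟨fun x => (hder x).differentiableAt, by simp, ?_⟩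
      rwa [show deriv (fun x => f x₀ + ∫ y in x₀..x, G y) = G from funext fun x => (hder x).deriv]
    · have hzero := hconv.norm_image_sub_le_of_norm_hasDerivWithin_le (C := 0)
        (f := fun x => (f x₀ + ∫ y in x₀..x, G y) - f x) (f' := fun _ => 0)
        (fun y hy => by
          have := (hder y).hasDerivWithinAt.sub (hd y hy).hasDerivWithinAt
          rwa [hGf hy, sub_self] at this)
        (by simp) hx₀ hx
      simpa [sub_eq_zero] using hzero

theorem Polynomial.derivative_surjective (R : Type*) [Field R] [CharZero R] :
    Function.Surjective (Polynomial.derivative : Polynomial R → Polynomial R) := by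
  intro p
  induction p using Polynomial.induction_on' with
  | add p q hp hq =>
    obtain ⟨P, rfl⟩ := hp
    obtain ⟨Q, rfl⟩ := hq
    exact ⟨P + Q, Polynomial.derivative_add⟩
  | monomial n c =>
    refine ⟨Polynomial.monomial (n + 1) (c / (n + 1)), ?_⟩
    have : (n : R) + 1 ≠ 0 := by exact_mod_cast n.succ_ne_zero
    rw [Polynomial.derivative_monomial]
    simp [this]

/-- The Weierstrass approximation theorem in `C^n`: on a compact interval, a `C^n` function and
its derivatives up to order `n` are simultaneously approximated by a polynomial. -/
theorem exists_polynomial_iteratedDeriv_near (a b : ℝ) (n : ℕ) {f : ℝ → ℝ} (hf : ContDiff ℝ n f)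
    {ε : ℝ} (hε : 0 < ε) :
    ∃ p : Polynomial ℝ, ∀ i ≤ n, ∀ x ∈ Set.Icc a b,
      |iteratedDeriv i (fun y => p.eval y - f y) x| ≤ ε := by
  induction n generalizing f ε with
  | zero =>
    obtain ⟨p, hp⟩ :=
      exists_polynomial_near_of_continuousOn a b f hf.continuous.continuousOn ε hε
    refine ⟨p, fun i hi x hx => ?_⟩
    obtain rfl : i = 0 := by omega
    simpa using (hp x hx).le
  | succ n ih =>
    push_cast at hf
    obtain ⟨hd, -, hf'⟩ := contDiff_succ_iff_deriv.1 hf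
    have hL : 0 < 1 + |b - a| := by positivity
    obtain ⟨p, hp⟩ := ih hf' (div_pos hε hL)
    obtain ⟨q, rfl⟩ := Polynomial.derivative_surjective ℝ p
    have hder : ∀ x, HasDerivAt
        (fun y => (q + Polynomial.C (f a - q.eval a)).eval y - f y)
        (q.derivative.eval x - deriv f x) x := fun x => by
      have := ((q + Polynomial.C (f a - q.eval a)).hasDerivAt x).sub (hd x).hasDerivAt
      rwa [Polynomial.derivative_add, Polynomial.derivative_C, add_zero] at this
    refine ⟨q + Polynomial.C (f a - q.eval a), fun i hi x hx => ?_⟩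
    have hsmall : ε / (1 + |b - a|) ≤ ε := div_le_self hε.le (by linarith [abs_nonneg (b - a)])
    cases i with
    | zero =>
      have hab : a ≤ b := hx.1.trans hx.2
      have := (convex_Icc a b).norm_image_sub_le_of_norm_hasDerivWithin_le
        (fun y _ => (hder y).hasDerivWithinAt)
        (fun y hy => by simpa using hp 0 (Nat.zero_le _) y hy) (Set.left_mem_Icc.2 hab) hx
      simp only [Polynomial.eval_add, Polynomial.eval_C, add_sub_cancel, sub_self, sub_zero,
        Real.norm_eq_abs] at this
      simp only [iteratedDeriv_zero, Polynomial.eval_add, Polynomial.eval_C]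
      refine this.trans ?_
      have hxa : |x - a| ≤ 1 + |b - a| := by
        rw [abs_of_nonneg (sub_nonneg.2 hx.1), abs_of_nonneg (sub_nonneg.2 hab)]
        linarith [hx.2]
      calc ε / (1 + |b - a|) * |x - a| ≤ ε / (1 + |b - a|) * (1 + |b - a|) := by gcongr
        _ = ε := div_mul_cancel₀ _ hL.ne'
    | succ i =>
      rw [iteratedDeriv_succ', show deriv _ = _ from funext fun x => (hder x).deriv]
      exact (hp i (by omega) x hx).trans hsmall

/-- Two `C^n` functions agreeing on a set of unique differentiability have the same derivatives
there. -/
theorem Set.EqOn.iteratedDeriv_of_uniqueDiffOn {s : Set ℝ} (hs : UniqueDiffOn ℝ s) {n : ℕ}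
    {f g : ℝ → ℝ} (hfg : Set.EqOn f g s) (hf : ContDiff ℝ n f) (hg : ContDiff ℝ n g) :
    Set.EqOn (iteratedDeriv n f) (iteratedDeriv n g) s := fun x hx => by
  rw [← iteratedDerivWithin_eq_iteratedDeriv hs hf.contDiffAt hx,
    ← iteratedDerivWithin_eq_iteratedDeriv hs hg.contDiffAt hx]
  exact iteratedDerivWithin_congr hfg hx

theorem ContDiff.exists_bound_iteratedDeriv_Icc (a b : ℝ) {n : ℕ} {f : ℝ → ℝ}
    (hf : ContDiff ℝ n f) :
    ∃ C, 1 ≤ C ∧ ∀ i ≤ n, ∀ x ∈ Set.Icc a b, |iteratedDeriv i f x| ≤ C := by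
  have h : ∀ i, ∃ C, i ≤ n → ∀ x ∈ Set.Icc a b, |iteratedDeriv i f x| ≤ C := fun i => by
    by_cases hi : i ≤ n
    · obtain ⟨C, hC⟩ := isCompact_Icc.exists_bound_of_continuousOn
        (hf.continuous_iteratedDeriv i (by exact_mod_cast hi)).continuousOn (s := Set.Icc a b)
      exact ⟨C, fun _ => hC⟩
    · exact ⟨0, fun h => absurd h hi⟩
  choose C hC using h
  refine ⟨1 + ∑ i ∈ Finset.range (n + 1), |C i|, ?_, fun i hi x hx => ?_⟩
  · linarith [Finset.sum_nonneg fun i (_ : i ∈ Finset.range (n + 1)) => abs_nonneg (C i)]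
  · have := Finset.single_le_sum (f := fun i => |C i|) (fun i _ => abs_nonneg (C i))
      (Finset.mem_range.2 (Nat.lt_succ_of_le hi))
    linarith [hC i hi x hx, le_abs_self (C i)]

/-- On a compact interval, multiplication by a `C^n` function and composition with a `C^n`
function are jointly bounded in the `C^n` norm. -/
theorem exists_bound_iteratedDeriv_comp_mul (a b c d : ℝ) {n : ℕ} {φ w : ℝ → ℝ}
    (hφ : ContDiff ℝ n φ) (hw : ContDiff ℝ n w)
    (hmaps : Set.MapsTo φ (Set.Icc a b) (Set.Icc c d)) :
    ∃ M, 0 < M ∧ ∀ E : ℝ → ℝ, ContDiff ℝ n E → ∀ η : ℝ, 0 ≤ η →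
      (∀ i ≤ n, ∀ y ∈ Set.Icc c d, |iteratedDeriv i E y| ≤ η) →
      ∀ s ≤ n, ∀ x ∈ Set.Icc a b, |iteratedDeriv s (fun r => E (φ r) * w r) x| ≤ M * η := by
  obtain ⟨D, hD1, hD⟩ := hφ.exists_bound_iteratedDeriv_Icc a b
  obtain ⟨W, hW1, hW⟩ := hw.exists_bound_iteratedDeriv_Icc a b
  refine ⟨2 ^ n * (n.factorial * D ^ n * W), by positivity, fun E hE η hη hEη s hs x hx => ?_⟩
  simp_rw [← Real.norm_eq_abs, ← norm_iteratedFDeriv_eq_norm_iteratedDeriv] at hD hW hEη ⊢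
  have hcomp : ∀ i ≤ n, ‖iteratedFDeriv ℝ i (E ∘ φ) x‖ ≤ n.factorial * η * D ^ n := fun i hi => by
    refine (norm_iteratedFDeriv_comp_le hE hφ (by exact_mod_cast hi) x
      (fun j hj => hEη j (hj.trans hi) _ (hmaps hx))
      (fun j hj hji => (hD j (hji.trans hi) x hx).trans (le_self_pow₀ hD1 (by omega)))).trans ?_
    gcongr
  refine (norm_iteratedFDeriv_mul_le (hE.comp hφ) hw x (by exact_mod_cast hs)).trans ?_
  calc _ ≤ ∑ i ∈ Finset.range (s + 1), (s.choose i : ℝ) * (n.factorial * η * D ^ n) * W := by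
        refine Finset.sum_le_sum fun i hi => ?_
        have hi' : i ≤ n := by have := Finset.mem_range.1 hi; omega
        gcongr
        · exact hcomp i hi'
        · exact hW _ (by omega) x hx
    _ = 2 ^ s * (n.factorial * D ^ n * W) * η := by
        rw [← Finset.sum_mul, ← Finset.sum_mul, ← Nat.cast_sum, Nat.sum_range_choose]
        push_cast
        ring
    _ ≤ 2 ^ n * (n.factorial * D ^ n * W) * η := by
        gcongr
        norm_num

/-- Small translations of a `C^n` function vanishing on `[c, ∞)` are close to it in the `C^n` norm
on `[a, ∞)`. -/
theorem exists_translate_iteratedDeriv_near (a c : ℝ) {n : ℕ} {F : ℝ → ℝ} (hF : ContDiff ℝ n F)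
    (hzero : ∀ r, c ≤ r → F r = 0) {ε : ℝ} (hε : 0 < ε) :
    ∃ δ, 0 < δ ∧ ∀ i ≤ n, ∀ r, a ≤ r →
      |iteratedDeriv i F r - iteratedDeriv i F (r + δ)| ≤ ε := by
  have hz : ∀ i ≤ n, ∀ r, c ≤ r → iteratedDeriv i F r = 0 := fun i hi r hr => by
    have := Set.EqOn.iteratedDeriv_of_uniqueDiffOn (uniqueDiffOn_Ici c) (g := fun _ => (0 : ℝ))
      (fun x hx => hzero x hx) (hF.of_le (by exact_mod_cast hi)) contDiff_const hr
    simpa using this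
  have h : ∀ i ≤ n, ∃ δ, 0 < δ ∧ ∀ x ∈ Set.Icc a (c + 1), ∀ y ∈ Set.Icc a (c + 1),
      |x - y| < δ → |iteratedDeriv i F x - iteratedDeriv i F y| < ε := fun i hi => by
    have := isCompact_Icc.uniformContinuousOn_of_continuous (s := Set.Icc a (c + 1))
      (hF.continuous_iteratedDeriv i (by exact_mod_cast hi)).continuousOn
    exact Metric.uniformContinuousOn_iff.1 this ε hε
  choose! δ hδpos hδ using h
  obtain ⟨m, hm, hmin⟩ := (Finset.range (n + 1)).exists_min_image δ ⟨0, by simp⟩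
  have hmpos : 0 < δ m := hδpos m (by have := Finset.mem_range.1 hm; omega)
  have hd1 : min (δ m / 2) 1 ≤ δ m / 2 := min_le_left _ _
  have hd2 : min (δ m / 2) 1 ≤ 1 := min_le_right _ _
  have hd0 : 0 < min (δ m / 2) 1 := lt_min (by linarith) one_pos
  refine ⟨min (δ m / 2) 1, hd0, fun i hi r hr => ?_⟩
  rcases le_total c r with hcr | hrc
  · rw [hz i hi r hcr, hz i hi _ (by linarith)]
    simpa using hε.le
  · refine (hδ i hi r ⟨hr, by linarith⟩ _ ⟨by linarith, by linarith⟩ ?_).le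
    have := hmin i (Finset.mem_range.2 (by omega))
    rw [sub_add_cancel_left, abs_neg, abs_of_pos hd0]
    linarith

/-- Construction of the orthogonal radial basis (Proposition 5.1): given a smooth coordinate
transform `ξ : [r₀, r_cut] → [a, b]` with smooth inverse, a `C^t` cutoff `f_cut` positive on
`[r₀, r_cut)` and vanishing on `[r_cut, ∞)`, a finite Borel measure `ρ` and polynomials
`J_n` of degree `n` orthonormal for the weighted measure `f_cut² ρ` (in the transformed
variable), the functions `P_n(r) = J_n(ξ(r)) f_cut(r)` (extended by `0` for `r ≥ r_cut`)
are `C^t` on `[r₀, ∞)`, vanish on `[r_cut, ∞)`, are orthonormal in `L²(ρ)`, are linearly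
independent, and their span is dense in the `C^t` functions on `[r₀, ∞)` supported in
`[r₀, r_cut]`. -/
theorem radial_basis_construction (r0 rcut a b : ℝ) (h0 : 0 ≤ r0) (hr : r0 < rcut)
    (t : ℕ) (ht : 1 ≤ t)
    (ξ ξinv : ℝ → ℝ)
    (hξsmooth : ContDiffOn ℝ (⊤ : ℕ∞) ξ (Set.Icc r0 rcut))
    (hξbij : Set.BijOn ξ (Set.Icc r0 rcut) (Set.Icc a b))
    (hξinvsmooth : ContDiffOn ℝ (⊤ : ℕ∞) ξinv (Set.Icc a b))
    (hξinv : Set.InvOn ξinv ξ (Set.Icc r0 rcut) (Set.Icc a b))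
    (fcut : ℝ → ℝ)
    (hfcutreg : ContDiffOn ℝ t fcut (Set.Ici r0))
    (hfcutpos : ∀ r ∈ Set.Ico r0 rcut, 0 < fcut r)
    (hfcutzero : ∀ r, rcut ≤ r → fcut r = 0)
    (ρ : Measure ℝ) [IsFiniteMeasure ρ]
    (J : ℕ → Polynomial ℝ)
    (hdeg : ∀ n : ℕ, (J n).degree = (n : WithBot ℕ))
    (horth : ∀ n m : ℕ,
      (∫ r in Set.Icc r0 rcut, (J n).eval (ξ r) * (J m).eval (ξ r) * (fcut r) ^ 2 ∂ρ)
        = if n = m then 1 else 0)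
    (P : ℕ → ℝ → ℝ)
    (hP : ∀ n : ℕ, ∀ r ∈ Set.Icc r0 rcut, P n r = (J n).eval (ξ r) * fcut r)
    (hP0 : ∀ n : ℕ, ∀ r : ℝ, rcut ≤ r → P n r = 0) :
    (∀ n : ℕ, ContDiffOn ℝ t (P n) (Set.Ici r0)) ∧
    (∀ n m : ℕ,
      (∫ r in Set.Icc r0 rcut, P n r * P m r ∂ρ) = if n = m then 1 else 0) ∧
    LinearIndependent ℝ (fun n : ℕ => (Set.Ici r0).restrict (P n)) ∧
    (∀ f : ℝ → ℝ, ContDiffOn ℝ t f (Set.Ici r0) → (∀ r, rcut ≤ r → f r = 0) →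
      ∀ ε : ℝ, 0 < ε → ∃ c : ℕ →₀ ℝ,
        ∀ s ≤ t, ∀ r : ℝ, r0 ≤ r →
          |iteratedDerivWithin s f (Set.Ici r0) r -
            iteratedDerivWithin s (fun x => c.sum fun n A => A * P n x) (Set.Ici r0) r|
            ≤ ε) := by
  have hIci : (interior (Set.Ici r0)).Nonempty := by simp
  have hIcc : (interior (Set.Icc r0 rcut)).Nonempty := by simpa using hr
  have hmem0 : r0 ∈ Set.Icc r0 rcut := ⟨le_rfl, hr.le⟩
  have hmem1 : rcut ∈ Set.Icc r0 rcut := ⟨hr.le, le_rfl⟩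
  have hab : a < b := by
    have h1 := hξbij.mapsTo hmem0
    have h2 := hξbij.mapsTo hmem1
    refine lt_of_le_of_ne (h1.1.trans h1.2) fun h => hr.ne (hξbij.injOn hmem0 hmem1 ?_)
    linarith [h1.1, h1.2, h2.1, h2.2]
  obtain ⟨Ξ, hΞ, hΞeq⟩ := (hξsmooth.of_le (by exact_mod_cast le_top : (t : WithTop ℕ∞) ≤ _)
    ).exists_contDiff_extension isClosed_Icc (convex_Icc _ _) hIcc
  obtain ⟨w, hw, hweq⟩ := hfcutreg.exists_contDiff_extension isClosed_Ici (convex_Ici _) hIci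
  have hwzero : ∀ r, rcut ≤ r → w r = 0 := fun r h => by
    rw [hweq (hr.le.trans h : r0 ≤ r), hfcutzero r h]
  have hPeq : ∀ n, ∀ r, r0 ≤ r → P n r = (J n).eval (Ξ r) * w r := fun n r h => by
    rcases le_total r rcut with hc | hc
    · rw [hP n r ⟨h, hc⟩, hΞeq ⟨h, hc⟩, hweq h]
    · rw [hP0 n r hc, hwzero r hc, mul_zero]
  have hsmooth : ∀ p : Polynomial ℝ, ContDiff ℝ t (fun r => p.eval (Ξ r) * w r) := fun p =>
    ((by simpa using p.contDiff_aeval (𝕜 := ℝ) (n := t)) : ContDiff ℝ t p.eval).comp hΞ |>.mul hw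
  have hPsmooth : ∀ n, ContDiffOn ℝ t (P n) (Set.Ici r0) := fun n =>
    (hsmooth (J n)).contDiffOn.congr fun r h => hPeq n r h
  have hPorth : ∀ n m : ℕ,
      (∫ r in Set.Icc r0 rcut, P n r * P m r ∂ρ) = if n = m then 1 else 0 := fun n m => by
    rw [← horth n m]
    refine setIntegral_congr_fun measurableSet_Icc fun r h => ?_
    simp only [hP n r h, hP m r h]
    ring
  refine ⟨hPsmooth, hPorth, ?_, fun f hf hfzero ε hε => ?_⟩
  · rw [linearIndependent_iff]
    intro l hl
    have hsum : ∀ r ∈ Set.Icc r0 rcut, ∑ n ∈ l.support, l n * P n r = 0 := fun r h => by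
      have := congrFun hl ⟨r, h.1⟩
      simp only [Finsupp.linearCombination_apply, Finsupp.sum, Finset.sum_apply, Pi.smul_apply,
        smul_eq_mul, Pi.zero_apply] at this
      exact this
    have hcont : ∀ n, ContinuousOn (P n) (Set.Icc r0 rcut) := fun n =>
      (hPsmooth n).continuousOn.mono Set.Icc_subset_Ici_self
    ext m
    calc l m = ∑ n ∈ l.support, l n * ∫ r in Set.Icc r0 rcut, P n r * P m r ∂ρ := by
          simp [hPorth]
      _ = ∫ r in Set.Icc r0 rcut, ∑ n ∈ l.support, l n * (P n r * P m r) ∂ρ := by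
          rw [integral_finsetSum]
          · simp_rw [integral_const_mul]
          · exact fun n _ =>
              (((hcont n).mul (hcont m)).integrableOn_compact isCompact_Icc).const_mul _
      _ = ∫ r in Set.Icc r0 rcut, (0 : ℝ) ∂ρ := by
          refine setIntegral_congr_fun measurableSet_Icc fun r h => ?_
          simp only [← mul_assoc, ← Finset.sum_mul, hsum r h, zero_mul]
      _ = 0 := by simp
  · obtain ⟨F, hF, hFeq⟩ := hf.exists_contDiff_extension isClosed_Ici (convex_Ici _) hIci
    have hFzero : ∀ r, rcut ≤ r → F r = 0 := fun r h => by
      rw [hFeq (hr.le.trans h : r0 ≤ r), hfzero r h]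
    obtain ⟨δ, hδ, hFδ⟩ := exists_translate_iteratedDeriv_near r0 rcut hF hFzero (half_pos hε)
    have hFδsmooth : ContDiff ℝ t fun r => F (r + δ) := hF.comp (contDiff_id.add contDiff_const)
    -- The translated function vanishes near `rcut`, so it may be divided by the cutoff.
    have hquot : ContDiffOn ℝ t (fun r => F (r + δ) / w r) (Set.Icc r0 rcut) := fun r h => by
      rcases h.2.lt_or_eq with hc | rfl
      · refine (hFδsmooth.contDiffAt.div hw.contDiffAt ?_).contDiffWithinAt
        rw [hweq h.1]
        exact (hfcutpos r ⟨h.1, hc⟩).ne'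
      · refine ((contDiffAt_const (c := (0 : ℝ))).congr_of_eventuallyEq ?_).contDiffWithinAt
        filter_upwards [lt_mem_nhds (sub_lt_self r hδ)] with x hx
        rw [hFzero _ (by linarith), zero_div]
    have hquotinv : ContDiffOn ℝ t (fun y => F (ξinv y + δ) / w (ξinv y)) (Set.Icc a b) :=
      hquot.comp (hξinvsmooth.of_le (by exact_mod_cast le_top)) (hξinv.1.mapsTo hξbij.surjOn)
    obtain ⟨K, hK, hKeq⟩ := hquotinv.exists_contDiff_extension isClosed_Icc (convex_Icc _ _)
      (by simpa using hab)
    have hfactor : Set.EqOn (fun r => F (r + δ)) (fun r => K (Ξ r) * w r) (Set.Ici r0) :=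
      fun r h => by
        change F (r + δ) = K (Ξ r) * w r
        rcases lt_or_ge r rcut with hc | hc
        · have hrmem : r ∈ Set.Icc r0 rcut := ⟨h, hc.le⟩
          have hwr : w r ≠ 0 := by rw [hweq h]; exact (hfcutpos r ⟨h, hc⟩).ne'
          rw [hΞeq hrmem, hKeq (hξbij.mapsTo hrmem)]
          simp only [hξinv.1 hrmem]
          rw [div_mul_cancel₀ _ hwr]
        · rw [hwzero r hc, hFzero _ (by linarith), mul_zero]
    have hmaps : Set.MapsTo Ξ (Set.Icc r0 rcut) (Set.Icc a b) := fun r h => by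
      rw [hΞeq h]; exact hξbij.mapsTo h
    obtain ⟨M, hM, hbound⟩ := exists_bound_iteratedDeriv_comp_mul r0 rcut a b hΞ hw hmaps
    obtain ⟨p, hp⟩ := exists_polynomial_iteratedDeriv_near a b t hK
      (div_pos (half_pos hε) hM)
    obtain ⟨c, hc⟩ : ∃ c : ℕ →₀ ℝ, (c.sum fun n A => A • J n) = p := by
      let S : Polynomial.Sequence ℝ := ⟨J, hdeg⟩
      refine Finsupp.mem_span_range_iff_exists_finsupp.1 (?_ : p ∈ Submodule.span ℝ (Set.range S))
      rw [S.span fun i => (Polynomial.leadingCoeff_ne_zero.2 (S.ne_zero i)).isUnit]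
      trivial
    have hq : Set.EqOn (fun x => c.sum fun n A => A * P n x) (fun x => p.eval (Ξ x) * w x)
        (Set.Ici r0) := fun x hx => by
      simp only [← hc, Finsupp.sum, Polynomial.eval_finsetSum, Finset.sum_mul,
        Polynomial.eval_smul, smul_eq_mul, hPeq _ x hx, mul_assoc]
    have hE : ContDiff ℝ t (fun y => p.eval y - K y) :=
      ((by simpa using p.contDiff_aeval (𝕜 := ℝ) (n := t)) : ContDiff ℝ t p.eval).sub hK
    refine ⟨c, fun s hs r hr0 => ?_⟩
    have hst : (s : WithTop ℕ∞) ≤ t := by exact_mod_cast hs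
    have hu : UniqueDiffOn ℝ (Set.Ici r0) := uniqueDiffOn_Ici r0
    have hKsmooth : ContDiff ℝ t fun r => K (Ξ r) * w r := (hK.comp hΞ).mul hw
    have hEsmooth : ContDiff ℝ t fun r => (p.eval (Ξ r) - K (Ξ r)) * w r := (hE.comp hΞ).mul hw
    rw [iteratedDerivWithin_congr hFeq.symm hr0, iteratedDerivWithin_congr hq hr0,
      iteratedDerivWithin_eq_iteratedDeriv hu (hF.of_le hst).contDiffAt hr0,
      iteratedDerivWithin_eq_iteratedDeriv hu ((hsmooth p).of_le hst).contDiffAt hr0]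
    have hshift : iteratedDeriv s F (r + δ) = iteratedDeriv s (fun r => K (Ξ r) * w r) r := by
      rw [← Set.EqOn.iteratedDeriv_of_uniqueDiffOn hu hfactor (hFδsmooth.of_le hst)
        (hKsmooth.of_le hst) hr0, iteratedDeriv_comp_add_const]
    have herr : |iteratedDeriv s (fun r => (p.eval (Ξ r) - K (Ξ r)) * w r) r| ≤ ε / 2 := by
      rcases le_total r rcut with hc | hc
      · have := hbound _ hE _ (div_pos (half_pos hε) hM).le hp s hs r ⟨hr0, hc⟩
        rwa [mul_div_cancel₀ _ hM.ne'] at this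
      · have := Set.EqOn.iteratedDeriv_of_uniqueDiffOn (uniqueDiffOn_Ici rcut)
          (g := fun _ => (0 : ℝ)) (fun x hx => by simp [hwzero x hx]) (hEsmooth.of_le hst)
          contDiff_const hc
        rw [this]
        simpa using (half_pos hε).le
    have hsplit : iteratedDeriv s (fun r => (p.eval (Ξ r) - K (Ξ r)) * w r) r =
        iteratedDeriv s (fun r => p.eval (Ξ r) * w r) r -
          iteratedDeriv s (fun r => K (Ξ r) * w r) r := by
      rw [← iteratedDeriv_fun_sub ((hsmooth p).of_le hst).contDiffAt
        (hKsmooth.of_le hst).contDiffAt]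
      simp only [sub_mul]
    have hnear := hFδ s hs r hr0
    rw [hsplit] at herr
    rw [hshift] at hnear
    rw [abs_le] at *
    constructor <;> linarith [hnear.1, hnear.2, herr.1, herr.2]
end
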